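/- arXiv:2403.12022 — 15 statements merged into one kernel-verified Lean document; each statement's English description precedes it below -/
import Mathlib

section
/- Let D, k, m be positive integers, A ⊆ ℂ^D an open connected set, Λ ⊆ ℂ an open set, and let M : A^{k+1} × Λ → Matrix (Fin m) (Fin m) ℂ be analytic, with M(u₀,…,u_k,λ) invertible for all (u₀,…,u_k,λ) ∈ A^{k+1} × Λ. Suppose that for all i, j ∈ {1,…,D} one has ∂/∂u₀^i ( (∂/∂u_k^j M(u₀,…,u_k,λ)) * M(u₀,…,u_k,λ)⁻¹ ) = 0 on A^{k+1} × Λ. Fix a₀ ∈ A. Then the matrix-valued function M̂(u₀,…,u_k,λ) := M(a₀,u₁,…,u_k,λ)⁻¹ * M(u₀,u₁,…,u_k,λ) * M(a₀,u₀,…,u_{k−1},λ) satisfies ∂/∂u_k^j M̂ = 0 on A^{k+1} × Λ for all j ∈ {1,…,D}; that is, applying the gauge transformation g(u₀,…,u_{k−1},λ) = M(a₀,u₀,…,u_{k−1},λ)⁻¹ eliminates the dependence of the S-part on u_k. -/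
/-- The matrix of partial derivatives of the entries of a matrix-valued function
`F = F(u₀,…,u_k, λ)` with respect to the coordinate `u_ℓ^i`. -/
noncomputable def blockPDeriv (D k m : ℕ)
    (F : (Fin (k+1) → Fin D → ℂ) → ℂ → Matrix (Fin m) (Fin m) ℂ)
    (ℓ : Fin (k+1)) (i : Fin D)
    (u : Fin (k+1) → Fin D → ℂ) (lam : ℂ) : Matrix (Fin m) (Fin m) ℂ :=
  Matrix.of fun a b =>
    fderiv ℂ (fun p : (Fin (k+1) → Fin D → ℂ) × ℂ => F p.1 p.2 a b) (u, lam)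
      ((Pi.single ℓ (Pi.single i (1:ℂ)), (0:ℂ)))

/-- From the blocks `(u₀,…,u_k)` form the shifted tuple of blocks `(a₀,u₀,…,u_{k-1})`. -/
def shiftIn (D k : ℕ) (a₀ : Fin D → ℂ) (u : Fin (k+1) → Fin D → ℂ) :
    Fin (k+1) → Fin D → ℂ :=
  Fin.cases (motive := fun _ => Fin D → ℂ) a₀ (fun i => u i.castSucc)

/-- The determinant of a matrix with differentiable entries is differentiable. -/
theorem differentiableAt_matrix_det {E : Type*} [NormedAddCommGroup E] [NormedSpace ℂ E]
    {n : Type*} [Fintype n] [DecidableEq n] {F : E → Matrix n n ℂ} {x : E}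
    (hF : ∀ a b, DifferentiableAt ℂ (fun y => F y a b) x) :
    DifferentiableAt ℂ (fun y => (F y).det) x := by
  simp only [Matrix.det_apply']
  refine DifferentiableAt.fun_sum fun σ _ => ?_
  refine DifferentiableAt.const_mul ?_ _
  exact (HasFDerivAt.finsetProd (g := fun i y => F y (σ i) i)
    fun i _ => (hF _ _).hasFDerivAt).differentiableAt

/-- The entries of the inverse of an invertible matrix with differentiable entries are
differentiable. -/
theorem differentiableAt_matrix_inv_apply {E : Type*} [NormedAddCommGroup E] [NormedSpace ℂ E]
    {n : Type*} [Fintype n] [DecidableEq n] {F : E → Matrix n n ℂ} {x : E}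
    (hF : ∀ a b, DifferentiableAt ℂ (fun y => F y a b) x) (hx : IsUnit (F x)) (a b : n) :
    DifferentiableAt ℂ (fun y => (F y)⁻¹ a b) x := by
  have hdet : (F x).det ≠ 0 := ((Matrix.isUnit_iff_isUnit_det _).1 hx).ne_zero
  simp only [Matrix.inv_def, Matrix.smul_apply, Ring.inverse_eq_inv', smul_eq_mul,
    Matrix.adjugate_apply]
  refine ((differentiableAt_matrix_det hF).fun_inv hdet).fun_mul
    (differentiableAt_matrix_det fun c d => ?_)
  by_cases h : c = b
  · subst h
    simp
  · simpa [Matrix.updateRow_ne h] using hF c d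

/-- Entrywise Leibniz rule for a product of matrix-valued functions of one variable. -/
theorem hasDerivAt_matrix_mul_apply {n : Type*} [Fintype n] {F G : ℂ → Matrix n n ℂ}
    {F' G' : Matrix n n ℂ} {t : ℂ} (hF : ∀ a b, HasDerivAt (fun s => F s a b) (F' a b) t)
    (hG : ∀ a b, HasDerivAt (fun s => G s a b) (G' a b) t) (a b : n) :
    HasDerivAt (fun s => (F s * G s) a b) ((F' * G t + F t * G') a b) t := by
  simp only [Matrix.mul_apply, Matrix.add_apply, ← Finset.sum_add_distrib]
  exact HasDerivAt.fun_sum fun c _ => (hF a c).fun_mul (hG c b)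

/-- If two curves of matrices have the same left logarithmic derivative `B` at `t`, then the
derivative of `N⁻¹ * F` vanishes at `t`. -/
theorem hasDerivAt_matrix_inv_mul_apply_zero {n : Type*} [Fintype n] [DecidableEq n]
    {N F : ℂ → Matrix n n ℂ} {B : Matrix n n ℂ} {t : ℂ}
    (hN : ∀ a b, HasDerivAt (fun s => N s a b) ((B * N t) a b) t)
    (hF : ∀ a b, HasDerivAt (fun s => F s a b) ((B * F t) a b) t)
    (hNu : IsUnit (N t)) (a b : n) :
    HasDerivAt (fun s => ((N s)⁻¹ * F s) a b) 0 t := by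
  have hdet : IsUnit (N t).det := (Matrix.isUnit_iff_isUnit_det _).1 hNu
  have hNd : ∀ a b, DifferentiableAt ℂ (fun s => N s a b) t := fun a b =>
    (hN a b).differentiableAt
  set V : Matrix n n ℂ := Matrix.of fun a b => deriv (fun s => (N s)⁻¹ a b) t with hV
  have hI : ∀ a b, HasDerivAt (fun s => (N s)⁻¹ a b) (V a b) t := fun a b =>
    (differentiableAt_matrix_inv_apply hNd hNu a b).hasDerivAt
  have hunit : ∀ᶠ s in nhds t, IsUnit (N s).det := by
    have hc := (differentiableAt_matrix_det hNd).continuousAt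
    filter_upwards [hc.eventually_ne hdet.ne_zero] with s hs using hs.isUnit
  have hVN : V * N t + (N t)⁻¹ * (B * N t) = 0 := by
    ext a b
    refine (hasDerivAt_matrix_mul_apply hI hN a b).unique ?_
    refine (hasDerivAt_const t ((1 : Matrix n n ℂ) a b)).congr_of_eventuallyEq ?_
    filter_upwards [hunit] with s hs
    rw [Matrix.nonsing_inv_mul _ hs]
  have hVeq : V = -((N t)⁻¹ * B) := by
    have h := congrArg (· * (N t)⁻¹) hVN
    simp only [Matrix.add_mul, Matrix.zero_mul, Matrix.mul_assoc,
      Matrix.mul_nonsing_inv _ hdet, Matrix.mul_one] at h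
    exact eq_neg_of_add_eq_zero_left h
  have h := hasDerivAt_matrix_mul_apply hI hF a b
  rwa [hVeq, Matrix.neg_mul, Matrix.mul_assoc, neg_add_cancel, Matrix.zero_apply] at h

/-- A function on blocks whose partial derivatives in the zeroth block vanish does not depend on
the zeroth block, as long as that block stays in an open connected set. -/
theorem eq_of_fderiv_zeroth_block_eq_zero {D k : ℕ} {A : Set (Fin D → ℂ)} (hA : IsOpen A)
    (hAc : IsPreconnected A) {f : (Fin (k+1) → Fin D → ℂ) × ℂ → ℂ}
    {u : Fin (k+1) → Fin D → ℂ} {lam : ℂ}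
    (hf : ∀ x ∈ A, DifferentiableAt ℂ f (Function.update u 0 x, lam))
    (hf0 : ∀ x ∈ A, ∀ i : Fin D, fderiv ℂ f (Function.update u 0 x, lam)
      (Pi.single (0 : Fin (k+1)) (Pi.single i (1:ℂ)), (0:ℂ)) = 0)
    {x y : Fin D → ℂ} (hx : x ∈ A) (hy : y ∈ A) :
    f (Function.update u 0 x, lam) = f (Function.update u 0 y, lam) := by
  have key : ∀ z ∈ A, HasFDerivAt (fun z => f (Function.update u 0 z, lam))
      (0 : (Fin D → ℂ) →L[ℂ] ℂ) z := by
    intro z hz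
    have h1 : HasFDerivAt (fun z : Fin D → ℂ => (Function.update u 0 z, lam))
        ((ContinuousLinearMap.pi (Pi.single (M := fun _ => (Fin D → ℂ) →L[ℂ] (Fin D → ℂ)) 0
          (ContinuousLinearMap.id ℂ (Fin D → ℂ)))).prod
          (0 : (Fin D → ℂ) →L[ℂ] ℂ)) z :=
      (hasFDerivAt_update u z).prodMk (hasFDerivAt_const lam z)
    have h2 := (hf z hz).hasFDerivAt.comp z h1
    refine h2.congr_fderiv ?_
    apply ContinuousLinearMap.coe_injective
    refine LinearMap.pi_ext' fun i => LinearMap.ext_ring ?_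
    have h3 := hf0 z hz i
    simp only [LinearMap.comp_apply, LinearMap.coe_single, ContinuousLinearMap.coe_coe,
      zero_apply, ContinuousLinearMap.comp_apply,
      ContinuousLinearMap.prod_apply]
    refine Eq.trans ?_ h3
    congr 2
    funext l
    by_cases hl : l = 0
    · subst hl
      simp
    · simp [hl]
  refine hA.is_const_of_fderiv_eq_zero (𝕜 := ℂ) hAc
    (fun z hz => (key z hz).differentiableAt.differentiableWithinAt)
    (fun z hz => (key z hz).fderiv) hx hy

theorem gauge_simplification_theorem
    (D k m : ℕ) (hD : 0 < D) (hk : 0 < k) (hm : 0 < m)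
    (A : Set (Fin D → ℂ)) (Λ : Set ℂ)
    (hAopen : IsOpen A) (hAconn : IsConnected A) (hΛopen : IsOpen Λ)
    (M : (Fin (k+1) → Fin D → ℂ) → ℂ → Matrix (Fin m) (Fin m) ℂ)
    (S : Set ((Fin (k+1) → Fin D → ℂ) × ℂ))
    (hS : S = {p | (∀ ℓ : Fin (k+1), p.1 ℓ ∈ A) ∧ p.2 ∈ Λ})
    (hMan : ∀ a b : Fin m,
      AnalyticOnNhd ℂ (fun p : (Fin (k+1) → Fin D → ℂ) × ℂ => M p.1 p.2 a b) S)
    (hMinv : ∀ p ∈ S, IsUnit (M p.1 p.2))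
    (hflat : ∀ (i j : Fin D), ∀ p ∈ S, ∀ a b : Fin m,
      fderiv ℂ (fun q : (Fin (k+1) → Fin D → ℂ) × ℂ =>
          (blockPDeriv D k m M (Fin.last k) j q.1 q.2 * (M q.1 q.2)⁻¹) a b) p
        ((Pi.single (0 : Fin (k+1)) (Pi.single i (1:ℂ)), (0:ℂ))) = 0)
    (a₀ : Fin D → ℂ) (ha₀ : a₀ ∈ A) :
    ∀ (j : Fin D), ∀ p ∈ S, ∀ a b : Fin m,
      fderiv ℂ (fun q : (Fin (k+1) → Fin D → ℂ) × ℂ =>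
          ((M (Function.update q.1 0 a₀) q.2)⁻¹ * M q.1 q.2
            * M (shiftIn D k a₀ q.1) q.2) a b) p
        ((Pi.single (Fin.last k) (Pi.single j (1:ℂ)), (0:ℂ))) = 0 := by
  classical
  subst hS
  intro j p hp a b
  set S : Set ((Fin (k+1) → Fin D → ℂ) × ℂ) := {p | (∀ ℓ : Fin (k+1), p.1 ℓ ∈ A) ∧ p.2 ∈ Λ}
  set e : (Fin (k+1) → Fin D → ℂ) × ℂ := (Pi.single (Fin.last k) (Pi.single j (1:ℂ)), (0:ℂ))
    with he
  have hlast : Fin.last k ≠ 0 := by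
    simpa [Fin.ext_iff] using hk.ne'
  have hupd : ∀ x ∈ A, (Function.update p.1 0 x, p.2) ∈ S := by
    intro x hx
    refine ⟨fun l => ?_, hp.2⟩
    by_cases hl : l = 0
    · subst hl
      simpa using hx
    · simpa [hl] using hp.1 l
  have hMd : ∀ q ∈ S, ∀ a b, DifferentiableAt ℂ
      (fun q : (Fin (k+1) → Fin D → ℂ) × ℂ => M q.1 q.2 a b) q :=
    fun q hq a b => (hMan a b q hq).differentiableAt
  have hBd : ∀ q ∈ S, ∀ a b, DifferentiableAt ℂ (fun q : (Fin (k+1) → Fin D → ℂ) × ℂ =>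
      (blockPDeriv D k m M (Fin.last k) j q.1 q.2 * (M q.1 q.2)⁻¹) a b) q := by
    intro q hq a b
    simp only [Matrix.mul_apply]
    refine DifferentiableAt.fun_sum fun c _ => DifferentiableAt.fun_mul ?_
      (differentiableAt_matrix_inv_apply (hMd q hq) (hMinv q hq) c b)
    simp only [blockPDeriv, Matrix.of_apply]
    exact (hMan a c q hq).fderiv.differentiableAt.clm_apply (differentiableAt_const _)
  set B := blockPDeriv D k m M (Fin.last k) j p.1 p.2 * (M p.1 p.2)⁻¹ with hB
  set p₀ : (Fin (k+1) → Fin D → ℂ) × ℂ := (Function.update p.1 0 a₀, p.2) with hp₀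
  have hp₀S : p₀ ∈ S := hupd a₀ ha₀
  have hB₀ : blockPDeriv D k m M (Fin.last k) j p₀.1 p₀.2 * (M p₀.1 p₀.2)⁻¹ = B := by
    ext c d
    have h := eq_of_fderiv_zeroth_block_eq_zero hAopen hAconn.isPreconnected
      (fun x hx => hBd _ (hupd x hx) c d) (fun x hx i => hflat i j _ (hupd x hx) c d)
      ha₀ (hp.1 0)
    simpa only [Function.update_eq_self] using h
  have hline : ∀ q ∈ S, ∀ a b, HasDerivAt (fun t : ℂ => M (q + t • e).1 (q + t • e).2 a b)
      (blockPDeriv D k m M (Fin.last k) j q.1 q.2 a b) 0 := fun q hq a b =>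
    (hMd q hq a b).hasFDerivAt.hasLineDerivAt e
  have hcancel : ∀ q ∈ S, ∀ X, X * (M q.1 q.2)⁻¹ * M q.1 q.2 = X := fun q hq X => by
    rw [Matrix.mul_assoc, Matrix.nonsing_inv_mul _ ((Matrix.isUnit_iff_isUnit_det _).1 (hMinv q hq)),
      Matrix.mul_one]
  have hquot : ∀ a b, HasDerivAt (fun t : ℂ => ((M (p₀ + t • e).1 (p₀ + t • e).2)⁻¹ *
      M (p + t • e).1 (p + t • e).2) a b) 0 0 := by
    refine hasDerivAt_matrix_inv_mul_apply_zero (B := B) ?_ ?_ ?_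
    · intro c d
      simpa only [zero_smul, add_zero, ← hB₀, hcancel p₀ hp₀S] using hline p₀ hp₀S c d
    · intro c d
      simpa only [zero_smul, add_zero, hB, hcancel p hp] using hline p hp c d
    · simpa only [zero_smul, add_zero] using hMinv p₀ hp₀S
  by_cases hd : DifferentiableAt ℂ (fun q : (Fin (k+1) → Fin D → ℂ) × ℂ =>
      ((M (Function.update q.1 0 a₀) q.2)⁻¹ * M q.1 q.2
        * M (shiftIn D k a₀ q.1) q.2) a b) p
  swap
  · rw [fderiv_zero_of_not_differentiableAt hd, zero_apply]
  refine HasDerivAt.unique (hd.hasFDerivAt.hasLineDerivAt e) ?_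
  have hshift : ∀ t : ℂ, shiftIn D k a₀ (p + t • e).1 = shiftIn D k a₀ p.1 := by
    intro t
    funext l
    refine Fin.cases rfl (fun i => ?_) l
    simp [shiftIn, he]
  have hupdt : ∀ t : ℂ, Function.update (p + t • e).1 0 a₀ = (p₀ + t • e).1 := by
    intro t
    funext l
    by_cases hl : l = 0
    · subst hl
      simp [hp₀, he, hlast.symm]
    · simp [hp₀, hl]
  have hsnd : ∀ q : (Fin (k+1) → Fin D → ℂ) × ℂ, ∀ t : ℂ, (q + t • e).2 = q.2 := by
    simp [he]
  have h := hasDerivAt_matrix_mul_apply (F' := 0) (G' := 0) hquot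
    (G := fun _ => M (shiftIn D k a₀ p.1) p.2) (fun c d => hasDerivAt_const _ _) a b
  simp only [Matrix.zero_mul, Matrix.mul_zero, add_zero, Matrix.zero_apply] at h
  simpa only [hshift, hupdt, hsnd] using h
end

section
/- Let z : ℤ × ℝ → ℂ be such that for each n the map t ↦ z(n,t) is differentiable and z satisfies the Itoh–Narita–Bogoyavlensky (INB) equation ∂ₜ z(n,t) = z(n,t)·(z(n+2,t) + z(n+1,t) − z(n−1,t) − z(n−2,t)). For λ ∈ ℂ define the 3×3 matrices M(n,t,λ) with rows (0, 1, 0), (0, 0, 1), (−z(n,t), 0, λ) and U(n,t,λ) with rows (z(n−2,t)+z(n−1,t), 0, λ), (−λ z(n,t), z(n−1,t)+z(n,t), λ²), (−λ² z(n,t), −λ z(n+1,t), λ³ + z(n,t) + z(n+1,t)). Then for all n, t, λ the Lax equation ∂ₜ M(n,t,λ) = U(n+1,t,λ) * M(n,t,λ) − M(n,t,λ) * U(n,t,λ) holds. -/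
/-- The S-part of the Lax pair of the Itoh–Narita–Bogoyavlensky equation. -/
noncomputable def MINB (z : ℤ × ℝ → ℂ) (n : ℤ) (t : ℝ) (lam : ℂ) :
    Matrix (Fin 3) (Fin 3) ℂ :=
  !![0, 1, 0;
     0, 0, 1;
     -z (n, t), 0, lam]

/-- The t-part of the Lax pair of the Itoh–Narita–Bogoyavlensky equation. -/
noncomputable def UINB (z : ℤ × ℝ → ℂ) (n : ℤ) (t : ℝ) (lam : ℂ) :
    Matrix (Fin 3) (Fin 3) ℂ :=
  !![z (n-2, t) + z (n-1, t), 0, lam;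
     -lam * z (n, t), z (n-1, t) + z (n, t), lam^2;
     -lam^2 * z (n, t), -lam * z (n+1, t), lam^3 + z (n, t) + z (n+1, t)]

theorem INB_Lax_pair (z : ℤ × ℝ → ℂ)
    (hdiff : ∀ n : ℤ, Differentiable ℝ (fun t => z (n, t)))
    (hINB : ∀ (n : ℤ) (t : ℝ),
      deriv (fun s => z (n, s)) t
        = z (n, t) * (z (n+2, t) + z (n+1, t) - z (n-1, t) - z (n-2, t))) :
    ∀ (n : ℤ) (t : ℝ) (lam : ℂ) (i j : Fin 3),
      deriv (fun s => MINB z n s lam i j) t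
        = (UINB z (n+1) t lam * MINB z n t lam
            - MINB z n t lam * UINB z n t lam) i j := by
  intro n t lam i j
  have h₀ : n + 1 - 1 = n := by ring
  have h₁ : n + 1 - 2 = n - 1 := by ring
  have h₂ : n + 1 + 1 = n + 2 := by ring
  fin_cases i <;> fin_cases j <;>
    simp [MINB, UINB, h₀, h₁, h₂, hINB] <;> ring
end

section
/- Fix α ∈ ℂ. Let u : ℤ × ℝ → ℂ be such that for each n the map t ↦ u(n,t) is differentiable and u satisfies the modified INB equation ∂ₜ u(n,t) = u(n,t)·(u(n,t) − α)·(u(n+2,t)·u(n+1,t) − u(n−1,t)·u(n−2,t)). Define z(n,t) := u(n+2,t)·u(n+1,t)·(u(n,t) − α). Then z satisfies the INB equation ∂ₜ z(n,t) = z(n,t)·(z(n+2,t) + z(n+1,t) − z(n−1,t) − z(n−2,t)); that is, z = u₂u₁(u₀ − α) is a Miura-type transformation from the modified INB equation to the INB equation. -/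
/-- The Miura-type transformation `z = u₂u₁(u₀ − α)` maps solutions of the modified
Itoh–Narita–Bogoyavlensky equation to solutions of the INB equation. -/
theorem miura_mINB_to_INB (α : ℂ) (u z : ℤ × ℝ → ℂ)
    (hdiff : ∀ n : ℤ, Differentiable ℝ (fun t => u (n, t)))
    (hmINB : ∀ (n : ℤ) (t : ℝ),
      deriv (fun s => u (n, s)) t
        = u (n, t) * (u (n, t) - α)
          * (u (n+2, t) * u (n+1, t) - u (n-1, t) * u (n-2, t)))
    (hz : ∀ (n : ℤ) (t : ℝ),
      z (n, t) = u (n+2, t) * u (n+1, t) * (u (n, t) - α)) :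
    ∀ (n : ℤ) (t : ℝ),
      deriv (fun s => z (n, s)) t
        = z (n, t) * (z (n+2, t) + z (n+1, t) - z (n-1, t) - z (n-2, t)) := by
  intro n t
  have hu (m : ℤ) := (hdiff m t).hasDerivAt
  simp only [hmINB] at hu
  have hderiv := ((hu (n + 2)).mul (hu (n + 1))).mul ((hu n).sub_const α)
  have hfun : (fun s => z (n, s)) =
      ((fun s => u (n + 2, s)) * fun s => u (n + 1, s)) * fun s => u (n, s) - α :=
    funext fun s => hz n s
  rw [hfun, hderiv.deriv]
  simp only [hz, Pi.mul_apply]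
  rw [show n + 2 + 2 = n + 4 by ring, show n + 2 + 1 = n + 3 by ring,
    show n + 2 - 1 = n + 1 by ring, show n + 2 - 2 = n by ring,
    show n + 1 + 2 = n + 3 by ring, show n + 1 + 1 = n + 2 by ring,
    show n + 1 - 1 = n by ring, show n + 1 - 2 = n - 1 by ring,
    show n - 1 + 2 = n + 1 by ring, show n - 1 + 1 = n by ring,
    show n - 2 + 2 = n by ring, show n - 2 + 1 = n - 1 by ring]
  ring
end

section
/- Fix α ∈ ℂ. Let u : ℤ × ℝ → ℂ be such that for each n the map t ↦ u(n,t) is differentiable and u satisfies the modified INB equation ∂ₜ u(n,t) = u(n,t)·(u(n,t) − α)·(u(n+2,t)·u(n+1,t) − u(n−1,t)·u(n−2,t)). Writing u_ℓ for u(n+ℓ,t), for λ ∈ ℂ define the 3×3 matrices M(n,t,λ) with rows (0, 1, 0), (0, 0, 1), ((α−u₀)u₁u₂, 0, λ) and U(n,t,λ) with rows (−u₀(αu₋₁ − u₋₂u₋₁ − u₁u₋₁ + αu₁), 0, λ), (λ(α−u₀)u₁u₂, −u₁(αu₀ − u₋₁u₀ − u₂u₀ + αu₂), λ²), (λ²(α−u₀)u₁u₂,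 λ(α−u₁)u₂u₃, λ³ − αu₁u₂ + u₀u₁u₂ − αu₂u₃ + u₁u₂u₃). Then for all n, t, λ the Lax equation ∂ₜ M(n,t,λ) = U(n+1,t,λ) * M(n,t,λ) − M(n,t,λ) * U(n,t,λ) holds. -/
/-- The S-part of the Lax pair of the modified INB equation. -/
noncomputable def MmINB (α : ℂ) (u : ℤ × ℝ → ℂ) (n : ℤ) (t : ℝ) (lam : ℂ) :
    Matrix (Fin 3) (Fin 3) ℂ :=
  !![0, 1, 0;
     0, 0, 1;
     (α - u (n, t)) * u (n+1, t) * u (n+2, t), 0, lam]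

/-- The t-part of the Lax pair of the modified INB equation. -/
noncomputable def UmINB (α : ℂ) (u : ℤ × ℝ → ℂ) (n : ℤ) (t : ℝ) (lam : ℂ) :
    Matrix (Fin 3) (Fin 3) ℂ :=
  !![-u (n, t) * (α * u (n-1, t) - u (n-2, t) * u (n-1, t)
        - u (n+1, t) * u (n-1, t) + α * u (n+1, t)), 0, lam;
     lam * (α - u (n, t)) * u (n+1, t) * u (n+2, t),
       -u (n+1, t) * (α * u (n, t) - u (n-1, t) * u (n, t)
         - u (n+2, t) * u (n, t) + α * u (n+2, t)), lam^2;
     lam^2 * (α - u (n, t)) * u (n+1, t) * u (n+2, t),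
       lam * (α - u (n+1, t)) * u (n+2, t) * u (n+3, t),
       lam^3 - α * u (n+1, t) * u (n+2, t) + u (n, t) * u (n+1, t) * u (n+2, t)
         - α * u (n+2, t) * u (n+3, t) + u (n+1, t) * u (n+2, t) * u (n+3, t)]

theorem mINB_Lax_pair (α : ℂ) (u : ℤ × ℝ → ℂ)
    (hdiff : ∀ n : ℤ, Differentiable ℝ (fun t => u (n, t)))
    (hmINB : ∀ (n : ℤ) (t : ℝ),
      deriv (fun s => u (n, s)) t
        = u (n, t) * (u (n, t) - α)
          * (u (n+2, t) * u (n+1, t) - u (n-1, t) * u (n-2, t))) :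
    ∀ (n : ℤ) (t : ℝ) (lam : ℂ) (i j : Fin 3),
      deriv (fun s => MmINB α u n s lam i j) t
        = (UmINB α u (n+1) t lam * MmINB α u n t lam
            - MmINB α u n t lam * UmINB α u n t lam) i j := by
  intro n t lam i j
  have hd (m : ℤ) : HasDerivAt (fun s => u (m, s))
      (u (m, t) * (u (m, t) - α)
        * (u (m+2, t) * u (m+1, t) - u (m-1, t) * u (m-2, t))) t :=
    hmINB m t ▸ (hdiff m t).hasDerivAt
  have hM := ((((hd n).const_sub α).mul (hd (n+1))).mul (hd (n+2))).deriv
  simp only [Pi.mul_def] at hM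
  have shifts : n+1+1 = n+2 ∧ n+1+2 = n+3 ∧ n+1+3 = n+4 ∧ n+1-1 = n ∧ n+1-2 = n-1
      ∧ n+2+1 = n+3 ∧ n+2+2 = n+4 ∧ n+2-1 = n+1 ∧ n+2-2 = n := by
    lia
  obtain ⟨h₁, h₂, h₃, h₄, h₅, h₆, h₇, h₈, h₉⟩ := shifts
  fin_cases i <;> fin_cases j <;>
    simp [MmINB, UmINB, hM,
      h₁, h₂, h₃, h₄, h₅, h₆, h₇, h₈, h₉] <;>
    ring
end

section
/- Fix α ∈ ℂ. For (u₀, u₁, u₂, λ) ∈ ℂ⁴ with (α − u₀)·u₁·u₂ ≠ 0, let M(u₀,u₁,u₂,λ) be the 3×3 complex matrix with rows (0, 1, 0), (0, 0, 1), ((α−u₀)u₁u₂, 0, λ). Then M(u₀,u₁,u₂,λ) is invertible and ∂/∂u₀ ( (∂/∂u₂ M(u₀,u₁,u₂,λ)) * M(u₀,u₁,u₂,λ)⁻¹ ) = 0 wherever M is defined; that is, M satisfies the 2-flatness condition. -/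
/-- A right inverse of the companion-type matrix with lower-left entry `c ≠ 0`. -/
theorem companion_mul_inverse {c : ℂ} (hc : c ≠ 0) (lam : ℂ) :
    (!![0, 1, 0; 0, 0, 1; c, 0, lam] : Matrix (Fin 3) (Fin 3) ℂ) *
      !![0, -lam / c, 1 / c; 1, 0, 0; 0, 1, 0] = 1 := by
  ext i j
  fin_cases i <;> fin_cases j <;> simp [Matrix.mul_apply, Fin.sum_univ_three] <;> field_simp <;> ring

/-- The entrywise derivative of the companion-type matrix whose lower-left entry is linear. -/
theorem of_deriv_companion (k u lam : ℂ) :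
    (Matrix.of fun a b => deriv (fun x =>
      (!![0, 1, 0; 0, 0, 1; k * x, 0, lam] : Matrix (Fin 3) (Fin 3) ℂ) a b) u) =
      !![0, 0, 0; 0, 0, 0; k, 0, 0] := by
  ext i j
  fin_cases i <;> fin_cases j <;> simp

/-- The S-part `M(u₀,u₁,u₂,λ)` of the Lax pair of the modified INB equation
satisfies the 2-flatness condition: it is invertible when `(α−u₀)u₁u₂ ≠ 0`, and
`∂/∂u₀ ( (∂/∂u₂ M) · M⁻¹ ) = 0` wherever it is defined. -/
theorem mINB_S_part_two_flat (α u₀ u₁ u₂ lam : ℂ)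
    (h : (α - u₀) * u₁ * u₂ ≠ 0) :
    IsUnit (!![0, 1, 0; 0, 0, 1; (α - u₀) * u₁ * u₂, 0, lam] :
        Matrix (Fin 3) (Fin 3) ℂ) ∧
    ∀ a b : Fin 3,
      deriv (fun y =>
        ((Matrix.of fun a' b' =>
            deriv (fun x =>
              (!![0, 1, 0; 0, 0, 1; (α - y) * u₁ * x, 0, lam] :
                Matrix (Fin 3) (Fin 3) ℂ) a' b') u₂)
          * (!![0, 1, 0; 0, 0, 1; (α - y) * u₁ * u₂, 0, lam] :
              Matrix (Fin 3) (Fin 3) ℂ)⁻¹) a b) u₀ = 0 := by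
  refine ⟨IsUnit.of_mul_eq_one _ (companion_mul_inverse h lam), fun a b => ?_⟩
  have hu₂ : u₂ ≠ 0 := right_ne_zero_of_mul h
  have hev : ∀ᶠ y in nhds u₀, (α - y) * u₁ * u₂ ≠ 0 :=
    ContinuousAt.eventually_ne (by fun_prop) h
  refine (Filter.EventuallyEq.deriv_eq (f := fun _ => (!![0, 0, 0; 0, 0, 0;
    0, -lam / u₂, 1 / u₂] : Matrix (Fin 3) (Fin 3) ℂ) a b) ?_).trans (deriv_const _ _)
  filter_upwards [hev] with y hy
  have hk : (α - y) * u₁ ≠ 0 := left_ne_zero_of_mul hy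
  rw [of_deriv_companion, Matrix.inv_eq_right_inv (companion_mul_inverse hy lam)]
  generalize (α - y) * u₁ = k at hk
  fin_cases a <;> fin_cases b <;> simp [Matrix.mul_apply, Fin.sum_univ_three] <;> field_simp
end

section
/- Fix α ∈ ℂ. Let u : ℤ × ℝ → ℂ be such that for each n the map t ↦ u(n,t) is differentiable and u satisfies the modified INB equation ∂ₜ u(n,t) = u(n,t)·(u(n,t) − α)·(u(n+2,t)·u(n+1,t) − u(n−1,t)·u(n−2,t)). Writing u_ℓ for u(n+ℓ,t), for λ ∈ ℂ define the 3×3 matrices M̃(n,t,λ) with rows (0, u₀−α, 0), (0, 0, 1), (−u₀u₁, 0, λ) and Ũ(n,t,λ) with rows (u₋₁(−αu₋₂ − αu₀ + u₀u₋₂ + u₀u₁), 0, −λ(α−u₋₁)), (−λu₀u₁, −u₀(αu₋₁ + αu₁ − u₋₂u₋₁ − u₁u₋₁), λ²), (−λ²u₀u₁, λu₁u₂(α−u₀), −αu₀u₁ − αu₁u₂ + λ³ + u₋₁u₀u₁ + u₀u₁u₂). Then for all n, t, λ the Lax equation ∂ₜ M̃(n,t,λ) = Ũ(n+1,t,λ)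 * M̃(n,t,λ) − M̃(n,t,λ) * Ũ(n,t,λ) holds. -/
/-- The S-part of the gauge-transformed Lax pair of the modified INB equation. -/
noncomputable def MtmINB (α : ℂ) (u : ℤ × ℝ → ℂ) (n : ℤ) (t : ℝ) (lam : ℂ) :
    Matrix (Fin 3) (Fin 3) ℂ :=
  !![0, u (n, t) - α, 0;
     0, 0, 1;
     -u (n, t) * u (n+1, t), 0, lam]

/-- The t-part of the gauge-transformed Lax pair of the modified INB equation. -/
noncomputable def UtmINB (α : ℂ) (u : ℤ × ℝ → ℂ) (n : ℤ) (t : ℝ) (lam : ℂ) :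
    Matrix (Fin 3) (Fin 3) ℂ :=
  !![u (n-1, t) * (-α * u (n-2, t) - α * u (n, t)
        + u (n, t) * u (n-2, t) + u (n, t) * u (n+1, t)), 0,
       -lam * (α - u (n-1, t));
     -lam * u (n, t) * u (n+1, t),
       -u (n, t) * (α * u (n-1, t) + α * u (n+1, t)
         - u (n-2, t) * u (n-1, t) - u (n+1, t) * u (n-1, t)), lam^2;
     -lam^2 * u (n, t) * u (n+1, t),
       lam * u (n+1, t) * u (n+2, t) * (α - u (n, t)),
       -α * u (n, t) * u (n+1, t) - α * u (n+1, t) * u (n+2, t) + lam^3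
         + u (n-1, t) * u (n, t) * u (n+1, t)
         + u (n, t) * u (n+1, t) * u (n+2, t)]

theorem gauge_transformed_mINB_Lax_pair (α : ℂ) (u : ℤ × ℝ → ℂ)
    (hdiff : ∀ n : ℤ, Differentiable ℝ (fun t => u (n, t)))
    (hmINB : ∀ (n : ℤ) (t : ℝ),
      deriv (fun s => u (n, s)) t
        = u (n, t) * (u (n, t) - α)
          * (u (n+2, t) * u (n+1, t) - u (n-1, t) * u (n-2, t))) :
    ∀ (n : ℤ) (t : ℝ) (lam : ℂ) (i j : Fin 3),
      deriv (fun s => MtmINB α u n s lam i j) t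
        = (UtmINB α u (n+1) t lam * MtmINB α u n t lam
            - MtmINB α u n t lam * UtmINB α u n t lam) i j := by
  intro n t lam i j
  have hmul : deriv (fun s => -u (n, s) * u (n+1, s)) t
      = -deriv (fun s => u (n, s)) t * u (n+1, t)
        + -u (n, t) * deriv (fun s => u (n+1, s)) t :=
    ((hdiff n t).hasDerivAt.neg.mul (hdiff (n+1) t).hasDerivAt).deriv
  rw [hmINB, hmINB] at hmul
  have e1 : n + 1 - 1 = n := by ring
  have e2 : n + 1 - 2 = n - 1 := by ring
  have e3 : n + 1 + 1 = n + 2 := by ring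
  have e4 : n + 1 + 2 = n + 3 := by ring
  simp only [e1, e2, e3, e4] at hmul
  fin_cases i <;> fin_cases j <;>
    simp [MtmINB, UtmINB, e1, e2, e3, e4,
      hmINB, -neg_mul, hmul] <;>
    ring
end

section
/- Fix α ∈ ℂ. For (u₀, u₁, λ) ∈ ℂ³ with (u₀ − α)·u₀·u₁ ≠ 0, let M̃(u₀,u₁,λ) be the 3×3 complex matrix with rows (0, u₀−α, 0), (0, 0, 1), (−u₀u₁, 0, λ). Then M̃(u₀,u₁,λ) is invertible and ∂/∂u₀ ( (∂/∂u₁ M̃(u₀,u₁,λ)) * M̃(u₀,u₁,λ)⁻¹ ) = 0 wherever M̃ is defined; that is, M̃ satisfies the 1-flatness condition. -/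
theorem mINB_S_part_one_det (α y x lam : ℂ) :
    (!![0, y - α, 0; 0, 0, 1; -y * x, 0, lam] : Matrix (Fin 3) (Fin 3) ℂ).det =
      -((y - α) * y * x) := by
  simp [Matrix.det_fin_three]
  ring

theorem mINB_S_part_one_deriv (α y x₀ lam : ℂ) :
    (Matrix.of fun a b => deriv (fun x =>
      (!![0, y - α, 0; 0, 0, 1; -y * x, 0, lam] : Matrix (Fin 3) (Fin 3) ℂ) a b) x₀) =
      !![0, 0, 0; 0, 0, 0; -y, 0, 0] := by
  have hd : deriv (fun x : ℂ => -y * x) x₀ = -y := by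
    simp
  ext a b
  fin_cases a <;> fin_cases b <;> first | exact hd | exact deriv_const _ _

/-- The logarithmic derivative in `u₁` does not depend on `u₀`. -/
theorem mINB_S_part_one_log_deriv (α y x lam : ℂ) (h : (y - α) * y * x ≠ 0) :
    (Matrix.of fun a b => deriv (fun t =>
      (!![0, y - α, 0; 0, 0, 1; -y * t, 0, lam] : Matrix (Fin 3) (Fin 3) ℂ) a b) x) *
      (!![0, y - α, 0; 0, 0, 1; -y * x, 0, lam] : Matrix (Fin 3) (Fin 3) ℂ)⁻¹ =
      !![0, 0, 0; 0, 0, 0; 0, -lam / x, 1 / x] := by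
  have hx : x ≠ 0 := right_ne_zero_of_mul h
  have hM : IsUnit (!![0, y - α, 0; 0, 0, 1; -y * x, 0, lam] :
      Matrix (Fin 3) (Fin 3) ℂ).det := by
    rw [mINB_S_part_one_det]
    exact (neg_ne_zero.mpr h).isUnit
  have hN : (!![0, 0, 0; 0, 0, 0; -y, 0, 0] : Matrix (Fin 3) (Fin 3) ℂ) =
      !![0, 0, 0; 0, 0, 0; 0, -lam / x, 1 / x] *
        !![0, y - α, 0; 0, 0, 1; -y * x, 0, lam] := by
    ext a b
    fin_cases a <;> fin_cases b <;> simp [Matrix.mul_apply, Fin.sum_univ_three] <;>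
      field_simp <;> ring
  rw [mINB_S_part_one_deriv, hN, Matrix.mul_nonsing_inv_cancel_right _ _ hM]

/-- The matrix `M̃(u₀,u₁,λ)` with rows `(0, u₀−α, 0)`, `(0, 0, 1)`, `(−u₀u₁, 0, λ)`
satisfies the 1-flatness condition: it is invertible when `(u₀−α)u₀u₁ ≠ 0`, and
`∂/∂u₀ ( (∂/∂u₁ M̃) · M̃⁻¹ ) = 0` wherever it is defined. -/
theorem mINB_S_part_one_flat (α u₀ u₁ lam : ℂ)
    (h : (u₀ - α) * u₀ * u₁ ≠ 0) :
    IsUnit (!![0, u₀ - α, 0; 0, 0, 1; -u₀ * u₁, 0, lam] :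
        Matrix (Fin 3) (Fin 3) ℂ) ∧
    ∀ a b : Fin 3,
      deriv (fun y =>
        ((Matrix.of fun a' b' =>
            deriv (fun x =>
              (!![0, y - α, 0; 0, 0, 1; -y * x, 0, lam] :
                Matrix (Fin 3) (Fin 3) ℂ) a' b') u₁)
          * (!![0, y - α, 0; 0, 0, 1; -y * u₁, 0, lam] :
              Matrix (Fin 3) (Fin 3) ℂ)⁻¹) a b) u₀ = 0 := by
  refine ⟨?_, fun a b => ?_⟩
  · rw [Matrix.isUnit_iff_isUnit_det, mINB_S_part_one_det]
    exact (neg_ne_zero.mpr h).isUnit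
  · have hev : ∀ᶠ y in nhds u₀, (y - α) * y * u₁ ≠ 0 :=
      ContinuousAt.eventually_ne (g := fun y : ℂ => (y - α) * y * u₁) (by fun_prop) h
    refine Filter.EventuallyEq.deriv_eq (f := fun _ =>
      (!![0, 0, 0; 0, 0, 0; 0, -lam / u₁, 1 / u₁] : Matrix (Fin 3) (Fin 3) ℂ) a b) ?_
      |>.trans (deriv_const _ _)
    filter_upwards [hev] with y hy
    rw [mINB_S_part_one_log_deriv α y u₁ lam hy]
end

section
/- Fix α ∈ ℂ with α ≠ 1. Let u : ℤ × ℝ → ℂ be such that for each n the map t ↦ u(n,t) is differentiable and u satisfies the modified INB equation ∂ₜ u(n,t) = u(n,t)·(u(n,t) − α)·(u(n+2,t)·u(n+1,t) − u(n−1,t)·u(n−2,t)). Writing u_ℓ for u(n+ℓ,t), for λ ∈ ℂ define the 3×3 matrices M̌(n,t,λ) with rows (0, −(α−1)u₀, 0), (0, 0, (α−u₀)/(α−1)), (−u₀, 0, λ) and Ǔ(n,t,λ) with rows (−αu₋₂u₋₁ − αu₀u₁ + u₋₂u₀u₋₁ + u₀u₁u₋₁, 0, −λu₋₁(α−u₋₂)),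 (−λu₀(α−u₋₁)/(α−1), −u₋₁(αu₋₂ + αu₀ − u₀u₋₂ − u₀u₁), λ²(α−u₋₁)/(α−1)), (−λ²u₀, (α−1)λu₀u₁, −αu₋₁u₀ − αu₀u₁ + λ³ + u₋₂u₋₁u₀ + u₋₁u₀u₁). Then for all n, t, λ the Lax equation ∂ₜ M̌(n,t,λ) = Ǔ(n+1,t,λ) * M̌(n,t,λ) − M̌(n,t,λ) * Ǔ(n,t,λ) holds. -/
/-- The S-part of the fully simplified Lax pair of the modified INB equation. -/
noncomputable def McmINB (α : ℂ) (u : ℤ × ℝ → ℂ) (n : ℤ) (t : ℝ) (lam : ℂ) :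
    Matrix (Fin 3) (Fin 3) ℂ :=
  !![0, -(α - 1) * u (n, t), 0;
     0, 0, (α - u (n, t)) / (α - 1);
     -u (n, t), 0, lam]

/-- The t-part of the fully simplified Lax pair of the modified INB equation. -/
noncomputable def UcmINB (α : ℂ) (u : ℤ × ℝ → ℂ) (n : ℤ) (t : ℝ) (lam : ℂ) :
    Matrix (Fin 3) (Fin 3) ℂ :=
  !![-α * u (n-2, t) * u (n-1, t) - α * u (n, t) * u (n+1, t)
        + u (n-2, t) * u (n, t) * u (n-1, t) + u (n, t) * u (n+1, t) * u (n-1, t),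
       0, -lam * u (n-1, t) * (α - u (n-2, t));
     -lam * u (n, t) * (α - u (n-1, t)) / (α - 1),
       -u (n-1, t) * (α * u (n-2, t) + α * u (n, t)
         - u (n, t) * u (n-2, t) - u (n, t) * u (n+1, t)),
       lam^2 * (α - u (n-1, t)) / (α - 1);
     -lam^2 * u (n, t), (α - 1) * lam * u (n, t) * u (n+1, t),
       -α * u (n-1, t) * u (n, t) - α * u (n, t) * u (n+1, t) + lam^3
         + u (n-2, t) * u (n-1, t) * u (n, t)
         + u (n-1, t) * u (n, t) * u (n+1, t)]

theorem simplified_mINB_Lax_pair (α : ℂ) (hα : α ≠ 1) (u : ℤ × ℝ → ℂ)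
    (hdiff : ∀ n : ℤ, Differentiable ℝ (fun t => u (n, t)))
    (hmINB : ∀ (n : ℤ) (t : ℝ),
      deriv (fun s => u (n, s)) t
        = u (n, t) * (u (n, t) - α)
          * (u (n+2, t) * u (n+1, t) - u (n-1, t) * u (n-2, t))) :
    ∀ (n : ℤ) (t : ℝ) (lam : ℂ) (i j : Fin 3),
      deriv (fun s => McmINB α u n s lam i j) t
        = (UcmINB α u (n+1) t lam * McmINB α u n t lam
            - McmINB α u n t lam * UcmINB α u n t lam) i j := by
  intro n t lam i j
  have hα' : α - 1 ≠ 0 := sub_ne_zero.mpr hα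
  have e₁ : n + 1 - 2 = n - 1 := by ring
  have e₂ : n + 1 - 1 = n := by ring
  have e₃ : n + 1 + 1 = n + 2 := by ring
  fin_cases i <;> fin_cases j <;>
    simp [McmINB, UcmINB, e₁, e₂, e₃, -neg_sub, hmINB] <;>
    field_simp <;> ring
end

section
/- Fix α, c ∈ ℂ. For a function v : ℤ × ℝ → ℂ write v_ℓ for v(n+ℓ,t), and set A = α³v₋₂v₋₁ − α³v₁v₂ + α²c v₋₂v₋₁v₁ + α²c v₋₂v₋₁v₂ − α²c v₋₂v₁v₂ − α²c v₋₁v₁v₂ − αc²v₋₁ + αc²v₁ + αc²v₂ − αc²v₋₂ − c³v₋₂v₋₁ + c³v₁v₂, D_ℓ = α³v_ℓv_{ℓ+1}v_{ℓ+2} + α³ + α²c v_ℓ + α²c v_{ℓ+1} + α²c v_{ℓ+2} − c³, and B = D₋₁ · D₀. Suppose v is differentiable in t for each n, satisfies ∂ₜ v = α⁴(α²v − c²)(α + cv)(αv₋₁v + c)(αvv₁ + c)·A / (D₋₂ · B) for all n, t (with v = v₀), and suppose D_ℓ(n,t) ≠ 0 for all n, t, ℓ. Define u(n,t) := α(αv₀v₁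 + c)(α²v₂ − c²) / D₀. Then u satisfies the modified INB equation ∂ₜ u(n,t) = u(n,t)·(u(n,t) − α)·(u(n+2,t)·u(n+1,t) − u(n−1,t)·u(n−2,t)); that is, u = α(αvv₁ + c)(α²v₂ − c²)/(α³vv₁v₂ + α³ + α²cv + α²cv₁ + α²cv₂ − c³) is a Miura-type transformation of order 2 from the new equation for v to the modified INB equation. -/
/-- The polynomial `A(v₋₂,v₋₁,v₁,v₂)` appearing in the doubly modified INB equation. -/
noncomputable def Aexpr (α c : ℂ) (v : ℤ × ℝ → ℂ) (n : ℤ) (t : ℝ) : ℂ :=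
  α^3 * v (n-2, t) * v (n-1, t) - α^3 * v (n+1, t) * v (n+2, t)
  + α^2 * c * v (n-2, t) * v (n-1, t) * v (n+1, t)
  + α^2 * c * v (n-2, t) * v (n-1, t) * v (n+2, t)
  - α^2 * c * v (n-2, t) * v (n+1, t) * v (n+2, t)
  - α^2 * c * v (n-1, t) * v (n+1, t) * v (n+2, t)
  - α * c^2 * v (n-1, t) + α * c^2 * v (n+1, t) + α * c^2 * v (n+2, t)
  - α * c^2 * v (n-2, t)
  - c^3 * v (n-2, t) * v (n-1, t) + c^3 * v (n+1, t) * v (n+2, t)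

/-- The factor `D_ℓ = α³v_ℓv_{ℓ+1}v_{ℓ+2} + α³ + α²c v_ℓ + α²c v_{ℓ+1} + α²c v_{ℓ+2} − c³`. -/
noncomputable def Dexpr (α c : ℂ) (v : ℤ × ℝ → ℂ) (ℓ n : ℤ) (t : ℝ) : ℂ :=
  α^3 * v (n+ℓ, t) * v (n+ℓ+1, t) * v (n+ℓ+2, t) + α^3
  + α^2 * c * v (n+ℓ, t) + α^2 * c * v (n+ℓ+1, t) + α^2 * c * v (n+ℓ+2, t) - c^3

/-- The polynomial identity behind the Miura transformation. The `D`s are the denominators at five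
consecutive sites, and `A₀`, `A₁`, `A₂` the values of `Aexpr` at the three sites occurring in `u`. -/
theorem miura_numerator_identity {R : Type*} [CommRing R]
    (α c p q x y z r s A₀ A₁ A₂ Dm₂ Dm₁ D₀ D₁ D₂ : R)
    (hA₀ : α * A₀ = (α * p * q + c) * D₀ - (α * y * z + c) * Dm₂)
    (hA₁ : α * A₁ = (α * q * x + c) * D₁ - (α * z * r + c) * Dm₁)
    (hA₂ : α * A₂ = (α * x * y + c) * D₂ - (α * r * s + c) * D₀)
    (hD₀ : α^2 * (c * z + α) * (α * x * y + c) - (α^2 * x - c^2) * (α^2 * y - c^2) = c * D₀)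
    (hD₂ : α^2 * (c * z + α) * (α * r * s + c) - (α^2 * r - c^2) * (α^2 * s - c^2) = c * D₂) :
    α * ((α^2 * x - c^2) * (α^2 * y - c^2) * (α * q * x + c) * A₀ * D₁ * D₂
        + (α^2 * x - c^2) * (α^2 * y - c^2) * (α * y * z + c) * A₁ * Dm₂ * D₂
        + α^2 * (c * z + α) * (α * y * z + c) * (α * z * r + c) * A₂ * Dm₂ * Dm₁)
      = -D₀ * ((α * y * z + c) * (α * z * r + c) * (α^2 * r - c^2) * (α^2 * s - c^2) * Dm₂ * Dm₁
        - (α * q * x + c) * (α * p * q + c) * (α^2 * x - c^2) * (α^2 * y - c^2) * D₁ * D₂) := by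
  linear_combination
    (α^2 * x - c^2) * (α^2 * y - c^2) * (α * q * x + c) * D₁ * D₂ * hA₀
    + (α^2 * x - c^2) * (α^2 * y - c^2) * (α * y * z + c) * Dm₂ * D₂ * hA₁
    + α^2 * (c * z + α) * (α * y * z + c) * (α * z * r + c) * Dm₂ * Dm₁ * hA₂
    + (α * y * z + c) * (α * z * r + c) * Dm₂ * Dm₁ * D₂ * hD₀
    - (α * y * z + c) * (α * z * r + c) * Dm₂ * Dm₁ * D₀ * hD₂

/-- The time derivative of the Miura substitution along a curve `(x, y, z)`, in factored form. -/
theorem hasDerivAt_miura {α c : ℂ} {x y z : ℝ → ℂ} {x' y' z' : ℂ} {t : ℝ}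
    (hx : HasDerivAt x x' t) (hy : HasDerivAt y y' t) (hz : HasDerivAt z z' t) {d : ℝ → ℂ}
    (hd : ∀ s, d s = α^3 * x s * y s * z s + α^3
      + α^2 * c * x s + α^2 * c * y s + α^2 * c * z s - c^3) (h0 : d t ≠ 0) :
    HasDerivAt (fun s => α * (α * x s * y s + c) * (α^2 * z s - c^2) / d s)
      (α^2 * ((α^2 * z t - c^2) * (α^2 * y t - c^2) * (c * y t + α) * x'
        + (α^2 * z t - c^2) * (α^2 * x t - c^2) * (c * x t + α) * y'
        + α^2 * (α * x t * y t + c) * (c * x t + α) * (c * y t + α) * z') / d t ^ 2) t := by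
  have hnum := ((((hx.const_mul α).mul hy).add_const c).const_mul α).mul
    ((hz.const_mul (α^2)).sub_const (c^2))
  have hden := (((((((hx.const_mul (α^3)).mul hy).mul hz).add_const (α^3)).add
    (hx.const_mul (α^2 * c))).add (hy.const_mul (α^2 * c))).add
    (hz.const_mul (α^2 * c))).sub_const (c^3)
  have hden' : HasDerivAt d _ t := hden.congr_of_eventuallyEq (.of_forall hd)
  refine (hnum.div hden' h0).congr_deriv ?_
  congr 1
  simp only [hd, Pi.mul_apply]
  ring

/-- The Miura-type transformation `u = α(αvv₁ + c)(α²v₂ − c²)/D₀` maps solutions of the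
doubly modified INB equation to solutions of the modified INB equation. -/
theorem miura_dmINB_to_mINB (α c : ℂ) (v u : ℤ × ℝ → ℂ)
    (hdiff : ∀ n : ℤ, Differentiable ℝ (fun t => v (n, t)))
    (hD : ∀ (n : ℤ) (t : ℝ) (ℓ : ℤ), Dexpr α c v ℓ n t ≠ 0)
    (heq : ∀ (n : ℤ) (t : ℝ),
      deriv (fun s => v (n, s)) t
        = α^4 * (α^2 * v (n, t) - c^2) * (α + c * v (n, t))
          * (α * v (n-1, t) * v (n, t) + c) * (α * v (n, t) * v (n+1, t) + c)
          * Aexpr α c v n t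
          / (Dexpr α c v (-2) n t * (Dexpr α c v (-1) n t * Dexpr α c v 0 n t)))
    (hu : ∀ (n : ℤ) (t : ℝ),
      u (n, t) = α * (α * v (n, t) * v (n+1, t) + c) * (α^2 * v (n+2, t) - c^2)
        / Dexpr α c v 0 n t) :
    ∀ (n : ℤ) (t : ℝ),
      deriv (fun s => u (n, s)) t
        = u (n, t) * (u (n, t) - α)
          * (u (n+2, t) * u (n+1, t) - u (n-1, t) * u (n-2, t)) := by
  intro n t
  have hA (m : ℤ) : α * Aexpr α c v m t
      = (α * v (m-2, t) * v (m-1, t) + c) * Dexpr α c v 0 m t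
        - (α * v (m+1, t) * v (m+2, t) + c) * Dexpr α c v (-2) m t := by
    simp only [Aexpr, Dexpr, add_zero, show m + -2 = m - 2 by ring,
      show m - 2 + 1 = m - 1 by ring, show m - 2 + 2 = m by ring]
    ring
  have hshift (ℓ m : ℤ) : Dexpr α c v ℓ m t = Dexpr α c v 0 (m+ℓ) t := by simp [Dexpr]
  have hD' (m : ℤ) : Dexpr α c v 0 m t ≠ 0 := hD m t 0
  have hv (m : ℤ) := ((hdiff m).differentiableAt (x := t)).hasDerivAt
  have hderiv := (hasDerivAt_miura (α := α) (c := c) (hv n) (hv (n+1)) (hv (n+2))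
    (d := fun s => Dexpr α c v 0 n s) (fun s => by simp [Dexpr]) (hD' n)).deriv
  have hA₀ := hA n
  have hA₁ := hA (n+1)
  have hA₂ := hA (n+2)
  have hD₀ : α^2 * (c * v (n+2, t) + α) * (α * v (n, t) * v (n+1, t) + c)
      - (α^2 * v (n, t) - c^2) * (α^2 * v (n+1, t) - c^2) = c * Dexpr α c v 0 n t := by
    simp only [Dexpr, add_zero]
    ring
  have hD₂ : α^2 * (c * v (n+2, t) + α) * (α * v (n+3, t) * v (n+4, t) + c)
      - (α^2 * v (n+3, t) - c^2) * (α^2 * v (n+4, t) - c^2) = c * Dexpr α c v 0 (n+2) t := by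
    simp only [Dexpr, add_zero, show n + 2 + 1 = n + 3 by ring, show n + 2 + 2 = n + 4 by ring]
    ring
  have hsub : u (n, t) - α
      = -α^2 * (c * v (n, t) + α) * (c * v (n+1, t) + α) / Dexpr α c v 0 n t := by
    rw [hu, eq_div_iff (hD' n), sub_mul, div_mul_cancel₀ _ (hD' n)]
    simp only [Dexpr, add_zero]
    ring
  rw [hsub]
  simp only [hu]
  rw [hderiv, heq, heq, heq]
  simp only [hshift (-1), hshift (-2),
    show n + 1 + 1 = n + 2 by ring, show n + 1 + 2 = n + 3 by ring, show n + 2 + 1 = n + 3 by ring,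
    show n + 2 + 2 = n + 4 by ring, show n + 1 - 1 = n by ring, show n + 1 - 2 = n - 1 by ring,
    show n + 2 - 1 = n + 1 by ring, show n + 2 - 2 = n by ring, show n + -1 = n - 1 by ring,
    show n + -2 = n - 2 by ring, show n - 2 + 1 = n - 1 by ring, show n - 2 + 2 = n by ring,
    show n - 1 + 1 = n by ring, show n - 1 + 2 = n + 1 by ring, show n + 1 + -1 = n by ring,
    show n + 1 + -2 = n - 1 by ring, show n + 2 + -1 = n + 1 by ring,
    show n + 2 + -2 = n by ring] at hA₀ hA₁ hA₂ ⊢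
  have key := miura_numerator_identity α c _ _ _ _ _ _ _ _ _ _ _ _ _ _ _ hA₀ hA₁ hA₂ hD₀ hD₂
  have hDm₂ := hD' (n-2)
  have hDm₁ := hD' (n-1)
  have hDn := hD' n
  have hD₁ := hD' (n+1)
  have hDn₂ := hD' (n+2)
  clear hderiv hsub hA₀ hA₁ hA₂ hD₀ hD₂
  generalize Dexpr α c v 0 (n-2) t = Dm₂, Dexpr α c v 0 (n-1) t = Dm₁, Dexpr α c v 0 n t = D₀,
    Dexpr α c v 0 (n+1) t = D₁, Dexpr α c v 0 (n+2) t = D₂, Aexpr α c v n t = A₀,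
    Aexpr α c v (n+1) t = A₁, Aexpr α c v (n+2) t = A₂, v (n-2, t) = p, v (n-1, t) = q,
    v (n, t) = x, v (n+1, t) = y, v (n+2, t) = z, v (n+3, t) = r, v (n+4, t) = s at *
  trans α^5 * (α * x * y + c) * (α^2 * z - c^2) * (c * x + α) * (c * y + α)
      / (D₀^3 * Dm₂ * Dm₁ * D₁ * D₂) *
    (α * ((α^2 * x - c^2) * (α^2 * y - c^2) * (α * q * x + c) * A₀ * D₁ * D₂
        + (α^2 * x - c^2) * (α^2 * y - c^2) * (α * y * z + c) * A₁ * Dm₂ * D₂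
        + α^2 * (c * z + α) * (α * y * z + c) * (α * z * r + c) * A₂ * Dm₂ * Dm₁))
  · field_simp
    ring
  · rw [key]
    field_simp
end

section
/- Fix α, c ∈ ℂ. For a function v : ℤ × ℝ → ℂ write v_ℓ for v(n+ℓ,t), and set A = α³v₋₂v₋₁ − α³v₁v₂ + α²c v₋₂v₋₁v₁ + α²c v₋₂v₋₁v₂ − α²c v₋₂v₁v₂ − α²c v₋₁v₁v₂ − αc²v₋₁ + αc²v₁ + αc²v₂ − αc²v₋₂ − c³v₋₂v₋₁ + c³v₁v₂ and D_ℓ = α³v_ℓv_{ℓ+1}v_{ℓ+2} + α³ + α²c v_ℓ + α²c v_{ℓ+1} + α²c v_{ℓ+2} − c³. Suppose v is differentiable in t for each n, satisfies ∂ₜ v = α⁴(α²v − c²)(α + cv)(αv₋₁v + c)(αvv₁ + c)·A / (D₋₂·D₋₁·D₀) for all n, t (with v = v₀), and suppose D_ℓ(n,t) ≠ 0 for all n, t, ℓ. Define z(n,t) := −α⁴(α + cv₀)(α + cv₁)(αv₁v₂ + c)(α²v₃ − c²)(αv₂v₃ + c)(α²v₄ − c²) / (D₀·D₁·D₂). Then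 z satisfies the INB equation ∂ₜ z(n,t) = z(n,t)·(z(n+2,t) + z(n+1,t) − z(n−1,t) − z(n−2,t)); that is, this formula is a Miura-type transformation of order 4 from the new equation for v to the INB equation, equal to the composition of the order-2 transformations u = α(αvv₁ + c)(α²v₂ − c²)/D₀ and z = u₂u₁(u₀ − α). -/
/-- The cubic polynomial of which `Dexpr` is the value at three consecutive sites. -/
def cubicD (α c x y w : ℂ) : ℂ :=
  α^3 * x * y * w + α^3 + α^2 * c * x + α^2 * c * y + α^2 * c * w - c^3

/-- The order-2 substitution from the doubly modified to the modified INB equation. -/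
noncomputable def miuraU (α c x y w : ℂ) : ℂ :=
  α * (α * x * y + c) * (α^2 * w - c^2) / cubicD α c x y w

/-- The right-hand side of the doubly modified INB equation, with its fraction split in two. -/
noncomputable def splitRHS (α c a b x y w : ℂ) : ℂ :=
  α^3 * (α^2 * x - c^2) * (α + c * x) * (α * b * x + c) * (α * x * y + c) / cubicD α c b x y
    * ((α * a * b + c) / cubicD α c a b x - (α * y * w + c) / cubicD α c x y w)

theorem splitRHS_eq (α c a b x y w : ℂ) (h₁ : cubicD α c a b x ≠ 0)
    (h₂ : cubicD α c b x y ≠ 0) (h₃ : cubicD α c x y w ≠ 0) :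
    α^4 * (α^2 * x - c^2) * (α + c * x) * (α * b * x + c) * (α * x * y + c)
      * (α^3 * a * b - α^3 * y * w + α^2 * c * a * b * y + α^2 * c * a * b * w
        - α^2 * c * a * y * w - α^2 * c * b * y * w - α * c^2 * b + α * c^2 * y + α * c^2 * w
        - α * c^2 * a - c^3 * a * b + c^3 * y * w)
      / (cubicD α c a b x * cubicD α c b x y * cubicD α c x y w)
      = splitRHS α c a b x y w := by
  rw [splitRHS, div_sub_div _ _ h₁ h₃, div_mul_div_comm,
    div_eq_div_iff (by positivity) (by positivity)]
  have key : (α * a * b + c) * cubicD α c x y w - cubicD α c a b x * (α * y * w + c)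
      = α * (α^3 * a * b - α^3 * y * w + α^2 * c * a * b * y + α^2 * c * a * b * w
        - α^2 * c * a * y * w - α^2 * c * b * y * w - α * c^2 * b + α * c^2 * y + α * c^2 * w
        - α * c^2 * a - c^3 * a * b + c^3 * y * w) := by
    unfold cubicD; ring
  rw [key]; ring

theorem miuraU_sub (α c x y w : ℂ) (h : cubicD α c x y w ≠ 0) :
    miuraU α c x y w - α = -(α^2 * (α + c * x) * (α + c * y)) / cubicD α c x y w := by
  rw [miuraU, div_sub' h]
  congr 1
  unfold cubicD; ring

theorem hasDerivAt_miuraU {α c : ℂ} {x y w : ℝ → ℂ} {x' y' w' : ℂ} {t : ℝ}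
    (hx : HasDerivAt x x' t) (hy : HasDerivAt y y' t) (hw : HasDerivAt w w' t)
    (h : cubicD α c (x t) (y t) (w t) ≠ 0) :
    HasDerivAt (fun s => miuraU α c (x s) (y s) (w s))
      (α^2 * ((α^2 * w t - c^2) * (α^2 * y t - c^2) * (α + c * y t) * x'
        + (α^2 * w t - c^2) * (α^2 * x t - c^2) * (α + c * x t) * y'
        + α^2 * (α * x t * y t + c) * (α + c * x t) * (α + c * y t) * w')
        / cubicD α c (x t) (y t) (w t) ^ 2) t := by
  have hN := (((hx.const_mul α).mul hy).add_const c |>.const_mul α).mul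
    ((hw.const_mul (α^2)).sub_const (c^2))
  have hC := ((((((hx.const_mul (α^3)).mul hy).mul hw).add_const (α^3)).add
    (hx.const_mul (α^2 * c))).add (hy.const_mul (α^2 * c))).add
    (hw.const_mul (α^2 * c)) |>.sub_const (c^3)
  have hQ := hN.div hC h
  refine hQ.congr_deriv ?_
  change _ / cubicD α c (x t) (y t) (w t) ^ 2 = _
  congr 1
  simp only [Pi.mul_apply, Pi.add_apply]
  ring

/-- Along the doubly modified INB equation, `miuraU` evolves by the modified INB equation
`u_t = u (u - α) (u₂ u₁ - u₋₁ u₋₂)`. -/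
theorem miuraU_evolution (α c x₀ x₁ x₂ x₃ x₄ x₅ x₆ : ℂ)
    (h₀ : cubicD α c x₀ x₁ x₂ ≠ 0) (h₁ : cubicD α c x₁ x₂ x₃ ≠ 0)
    (h₂ : cubicD α c x₂ x₃ x₄ ≠ 0) (h₃ : cubicD α c x₃ x₄ x₅ ≠ 0)
    (h₄ : cubicD α c x₄ x₅ x₆ ≠ 0) :
    α^2 * ((α^2 * x₄ - c^2) * (α^2 * x₃ - c^2) * (α + c * x₃) * splitRHS α c x₀ x₁ x₂ x₃ x₄
        + (α^2 * x₄ - c^2) * (α^2 * x₂ - c^2) * (α + c * x₂) * splitRHS α c x₁ x₂ x₃ x₄ x₅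
        + α^2 * (α * x₂ * x₃ + c) * (α + c * x₂) * (α + c * x₃)
          * splitRHS α c x₂ x₃ x₄ x₅ x₆) / cubicD α c x₂ x₃ x₄ ^ 2
      = miuraU α c x₂ x₃ x₄ * (miuraU α c x₂ x₃ x₄ - α)
        * (miuraU α c x₄ x₅ x₆ * miuraU α c x₃ x₄ x₅
          - miuraU α c x₁ x₂ x₃ * miuraU α c x₀ x₁ x₂) := by
  rw [miuraU_sub _ _ _ _ _ h₂]
  have e₂ : α^2 * (α + c * x₄) * (α * x₂ * x₃ + c) - (α^2 * x₂ - c^2) * (α^2 * x₃ - c^2)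
      = c * cubicD α c x₂ x₃ x₄ := by
    unfold cubicD; ring
  have e₄ : α^2 * (α + c * x₄) * (α * x₅ * x₆ + c) - (α^2 * x₅ - c^2) * (α^2 * x₆ - c^2)
      = c * cubicD α c x₄ x₅ x₆ := by
    unfold cubicD; ring
  unfold splitRHS miuraU
  generalize cubicD α c x₀ x₁ x₂ = d₀ at *
  generalize cubicD α c x₁ x₂ x₃ = d₁ at *
  generalize cubicD α c x₂ x₃ x₄ = d₂ at *
  generalize cubicD α c x₃ x₄ x₅ = d₃ at *
  generalize cubicD α c x₄ x₅ x₆ = d₄ at *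
  generalize α * x₀ * x₁ + c = p₀ at *
  generalize α * x₁ * x₂ + c = p₁ at *
  generalize α * x₂ * x₃ + c = p₂ at *
  generalize α * x₃ * x₄ + c = p₃ at *
  generalize α * x₄ * x₅ + c = p₄ at *
  generalize α * x₅ * x₆ + c = p₅ at *
  generalize α^2 * x₂ - c^2 = q₂ at *
  generalize α^2 * x₃ - c^2 = q₃ at *
  generalize α^2 * x₄ - c^2 = q₄ at *
  generalize α^2 * x₅ - c^2 = q₅ at *
  generalize α^2 * x₆ - c^2 = q₆ at *
  generalize α + c * x₂ = r₂ at *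
  generalize α + c * x₃ = r₃ at *
  generalize α + c * x₄ = r₄ at *
  field_simp
  linear_combination α^5 * q₄ * r₂ * r₃ * p₂ * p₃ * p₄ * d₀ * d₁ * (d₄ * e₂ - d₂ * e₄)

theorem hasDerivAt_mul_mul_sub {α : ℂ} {u₀ u₁ u₂ : ℝ → ℂ} {a b u₃ u₄ : ℂ} {t : ℝ}
    (h₀ : HasDerivAt u₀ (u₀ t * (u₀ t - α) * (u₂ t * u₁ t - b * a)) t)
    (h₁ : HasDerivAt u₁ (u₁ t * (u₁ t - α) * (u₃ * u₂ t - u₀ t * b)) t)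
    (h₂ : HasDerivAt u₂ (u₂ t * (u₂ t - α) * (u₄ * u₃ - u₁ t * u₀ t)) t) :
    HasDerivAt (fun s => u₂ s * u₁ s * (u₀ s - α))
      (u₂ t * u₁ t * (u₀ t - α) * (u₄ * u₃ * (u₂ t - α) + u₃ * u₂ t * (u₁ t - α)
        - u₁ t * u₀ t * (b - α) - u₀ t * b * (a - α))) t := by
  refine ((h₂.mul h₁).mul (h₀.sub_const α)).congr_deriv ?_
  simp only [Pi.mul_apply]
  ring

/-- The order-4 Miura-type transformation from the doubly modified INB equation
to the INB equation. -/
theorem miura_dmINB_to_INB (α c : ℂ) (v z : ℤ × ℝ → ℂ)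
    (hdiff : ∀ n : ℤ, Differentiable ℝ (fun t => v (n, t)))
    (hD : ∀ (n : ℤ) (t : ℝ) (ℓ : ℤ), Dexpr α c v ℓ n t ≠ 0)
    (heq : ∀ (n : ℤ) (t : ℝ),
      deriv (fun s => v (n, s)) t
        = α^4 * (α^2 * v (n, t) - c^2) * (α + c * v (n, t))
          * (α * v (n-1, t) * v (n, t) + c) * (α * v (n, t) * v (n+1, t) + c)
          * Aexpr α c v n t
          / (Dexpr α c v (-2) n t * Dexpr α c v (-1) n t * Dexpr α c v 0 n t))
    (hz : ∀ (n : ℤ) (t : ℝ),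
      z (n, t) = -(α^4 * (α + c * v (n, t)) * (α + c * v (n+1, t))
          * (α * v (n+1, t) * v (n+2, t) + c) * (α^2 * v (n+3, t) - c^2)
          * (α * v (n+2, t) * v (n+3, t) + c) * (α^2 * v (n+4, t) - c^2))
        / (Dexpr α c v 0 n t * Dexpr α c v 1 n t * Dexpr α c v 2 n t)) :
    ∀ (n : ℤ) (t : ℝ),
      deriv (fun s => z (n, s)) t
        = z (n, t) * (z (n+2, t) + z (n+1, t) - z (n-1, t) - z (n-2, t)) := by
  intro n t
  have hC (m : ℤ) (s : ℝ) : cubicD α c (v (m, s)) (v (m+1, s)) (v (m+2, s)) ≠ 0 := by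
    simpa [Dexpr, cubicD] using hD m s 0
  have hv (m : ℤ) (s : ℝ) : HasDerivAt (fun s => v (m, s))
      (splitRHS α c (v (m-2, s)) (v (m-1, s)) (v (m, s)) (v (m+1, s)) (v (m+2, s))) s := by
    refine (hdiff m s).hasDerivAt.congr_deriv ((heq m s).trans ?_)
    have k₁ := hC (m-2) s
    have k₂ := hC (m-1) s
    rw [show m - 2 + 1 = m - 1 by ring, show m - 2 + 2 = m by ring] at k₁
    rw [show m - 1 + 1 = m by ring, show m - 1 + 2 = m + 1 by ring] at k₂
    rw [← splitRHS_eq α c _ _ _ _ _ k₁ k₂ (hC m s)]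
    simp only [Aexpr, Dexpr, cubicD, add_zero, show m + -2 = m - 2 by ring,
      show m - 2 + 1 = m - 1 by ring, show m - 2 + 2 = m by ring, show m + -1 = m - 1 by ring,
      show m - 1 + 1 = m by ring, show m - 1 + 2 = m + 1 by ring]
  let u (m : ℤ) (s : ℝ) : ℂ := miuraU α c (v (m, s)) (v (m+1, s)) (v (m+2, s))
  have hu (m : ℤ) (s : ℝ) : HasDerivAt (u m)
      (u m s * (u m s - α) * (u (m+2) s * u (m+1) s - u (m-1) s * u (m-2) s)) s := by
    refine (hasDerivAt_miuraU (hv m s) (hv (m+1) s) (hv (m+2) s) (hC m s)).congr_deriv ?_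
    have k₀ := hC (m-2) s
    have k₁ := hC (m-1) s
    have k₃ := hC (m+1) s
    have k₄ := hC (m+2) s
    simp only [u, show m - 2 + 1 = m - 1 by ring, show m - 2 + 2 = m by ring,
      show m - 1 + 1 = m by ring, show m - 1 + 2 = m + 1 by ring,
      show m + 1 - 2 = m - 1 by ring, show m + 1 - 1 = m by ring,
      show m + 1 + 1 = m + 2 by ring, show m + 1 + 2 = m + 3 by ring,
      show m + 2 - 2 = m by ring, show m + 2 - 1 = m + 1 by ring,
      show m + 2 + 1 = m + 3 by ring, show m + 2 + 2 = m + 4 by ring] at k₀ k₁ k₃ k₄ ⊢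
    exact miuraU_evolution α c _ _ _ _ _ _ _ k₀ k₁ (hC m s) k₃ k₄
  have hzu (m : ℤ) (s : ℝ) : z (m, s) = u (m+2) s * u (m+1) s * (u m s - α) := by
    simp only [hz, u]
    rw [miuraU_sub _ _ _ _ _ (hC m s)]
    simp only [miuraU, Dexpr, cubicD, add_zero,
      show m + 1 + 1 = m + 2 by ring, show m + 1 + 2 = m + 3 by ring,
      show m + 2 + 1 = m + 3 by ring, show m + 2 + 2 = m + 4 by ring]
    rw [div_mul_div_comm, div_mul_div_comm]
    congr 1 <;> ring
  have h₁ := hu (n+1) t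
  have h₂ := hu (n+2) t
  simp only [hzu, show n + 2 + 2 = n + 4 by ring, show n + 2 + 1 = n + 3 by ring,
    show n + 1 + 2 = n + 3 by ring, show n + 1 + 1 = n + 2 by ring,
    show n - 1 + 2 = n + 1 by ring, show n - 1 + 1 = n by ring,
    show n - 2 + 2 = n by ring, show n - 2 + 1 = n - 1 by ring,
    show n + 1 - 1 = n by ring, show n + 1 - 2 = n - 1 by ring,
    show n + 2 - 1 = n + 1 by ring, show n + 2 - 2 = n by ring] at h₁ h₂ ⊢
  exact (hasDerivAt_mul_mul_sub (hu n t) h₁ h₂).deriv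
end

section
/- Fix α ∈ ℂ. Let u¹, u² : ℤ × ℝ → ℂ be differentiable in t for each n, with u¹(n,t) ≠ u²(n,t) for all n, t, and suppose (u¹, u²) satisfies the modified Toda system: ∂ₜ u¹₀ = u¹₀·H¹/((u¹₋₁ − u²₋₁)(u¹₀ − u²₀)) and ∂ₜ u²₀ = −u²₀·H²/((u¹₋₁ − u²₋₁)(u²₀ − u¹₀)), where subscript ℓ denotes the shift n ↦ n+ℓ, H¹ = −αu²₋₁u¹₀ + αu¹₋₁u²₀ + u²₋₁(u¹₀)² − 2u²₋₁u²₀u¹₀ + u²₋₁(u²₀)² − u¹₋₁u¹₁u²₀ + u¹₁u²₋₁u²₀ + u¹₋₁u²₀u²₁ − u²₋₁u²₀u²₁, and H² = −αu²₋₁u¹₀ + αu¹₋₁u²₀ + u¹₋₁(u¹₀)² − u¹₋₁u¹₁u¹₀ + u¹₁u²₋₁u¹₀ − 2u¹₋₁u²₀u¹₀ + u¹₋₁u²₁u¹₀ − u²₋₁u²₁u¹₀ + u¹₋₁(u²₀)². Define s¹(n,t) := u¹₀u²₀(u¹₁ − u²₁ − α)/(u¹₀ − u²₀) and s²(n,t)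 := (αu²₀ − u¹₁u¹₀ + u²₀u²₁)/(u¹₀ − u²₀). Then (s¹, s²) satisfies the Toda lattice in Flaschka–Manakov coordinates: ∂ₜ s¹(n,t) = s¹(n,t)·(s²(n,t) − s²(n−1,t)) and ∂ₜ s²(n,t) = s¹(n+1,t) − s¹(n,t); that is, these formulas give a Miura-type transformation from the modified Toda system to the Toda lattice in Flaschka–Manakov coordinates. -/
/-- The polynomial `H¹` of the modified Toda system. -/
noncomputable def H1mT (α : ℂ) (u1 u2 : ℤ × ℝ → ℂ) (n : ℤ) (t : ℝ) : ℂ :=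
  -α * u2 (n-1, t) * u1 (n, t) + α * u1 (n-1, t) * u2 (n, t)
  + u2 (n-1, t) * (u1 (n, t))^2 - 2 * u2 (n-1, t) * u2 (n, t) * u1 (n, t)
  + u2 (n-1, t) * (u2 (n, t))^2 - u1 (n-1, t) * u1 (n+1, t) * u2 (n, t)
  + u1 (n+1, t) * u2 (n-1, t) * u2 (n, t) + u1 (n-1, t) * u2 (n, t) * u2 (n+1, t)
  - u2 (n-1, t) * u2 (n, t) * u2 (n+1, t)

/-- The polynomial `H²` of the modified Toda system. -/
noncomputable def H2mT (α : ℂ) (u1 u2 : ℤ × ℝ → ℂ) (n : ℤ) (t : ℝ) : ℂ :=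
  -α * u2 (n-1, t) * u1 (n, t) + α * u1 (n-1, t) * u2 (n, t)
  + u1 (n-1, t) * (u1 (n, t))^2 - u1 (n-1, t) * u1 (n+1, t) * u1 (n, t)
  + u1 (n+1, t) * u2 (n-1, t) * u1 (n, t) - 2 * u1 (n-1, t) * u2 (n, t) * u1 (n, t)
  + u1 (n-1, t) * u2 (n+1, t) * u1 (n, t) - u2 (n-1, t) * u2 (n+1, t) * u1 (n, t)
  + u1 (n-1, t) * (u2 (n, t))^2

/-- The Miura-type transformation from the modified Toda system to the Toda lattice
in Flaschka–Manakov coordinates. -/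
theorem miura_mToda_to_toda (α : ℂ) (u1 u2 s1 s2 : ℤ × ℝ → ℂ)
    (hdiff1 : ∀ n : ℤ, Differentiable ℝ (fun t => u1 (n, t)))
    (hdiff2 : ∀ n : ℤ, Differentiable ℝ (fun t => u2 (n, t)))
    (hne : ∀ (n : ℤ) (t : ℝ), u1 (n, t) ≠ u2 (n, t))
    (heq1 : ∀ (n : ℤ) (t : ℝ),
      deriv (fun s => u1 (n, s)) t
        = u1 (n, t) * H1mT α u1 u2 n t
          / ((u1 (n-1, t) - u2 (n-1, t)) * (u1 (n, t) - u2 (n, t))))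
    (heq2 : ∀ (n : ℤ) (t : ℝ),
      deriv (fun s => u2 (n, s)) t
        = -(u2 (n, t) * H2mT α u1 u2 n t)
          / ((u1 (n-1, t) - u2 (n-1, t)) * (u2 (n, t) - u1 (n, t))))
    (hs1 : ∀ (n : ℤ) (t : ℝ),
      s1 (n, t) = u1 (n, t) * u2 (n, t) * (u1 (n+1, t) - u2 (n+1, t) - α)
        / (u1 (n, t) - u2 (n, t)))
    (hs2 : ∀ (n : ℤ) (t : ℝ),
      s2 (n, t) = (α * u2 (n, t) - u1 (n+1, t) * u1 (n, t) + u2 (n, t) * u2 (n+1, t))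
        / (u1 (n, t) - u2 (n, t))) :
    ∀ (n : ℤ) (t : ℝ),
      deriv (fun s => s1 (n, s)) t = s1 (n, t) * (s2 (n, t) - s2 (n-1, t)) ∧
      deriv (fun s => s2 (n, s)) t = s1 (n+1, t) - s1 (n, t) := by
  intro n t
  have hd (m : ℤ) : u1 (m, t) - u2 (m, t) ≠ 0 := sub_ne_zero.mpr (hne m t)
  have hu (m : ℤ) := (hdiff1 m t).hasDerivAt
  have hv (m : ℤ) := (hdiff2 m t).hasDerivAt
  have hneg (m : ℤ) : u2 (m, t) - u1 (m, t) = -(u1 (m, t) - u2 (m, t)) := by ring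
  have h1 := ((((hu n).mul (hv n)).mul (((hu (n+1)).sub (hv (n+1))).sub_const α)).div
    ((hu n).sub (hv n)) (hd n)).congr_of_eventuallyEq (.of_forall fun s => hs1 n s)
  have h2 := (((((hv n).const_mul α).sub ((hu (n+1)).mul (hu n))).add
    ((hv n).mul (hv (n+1)))).div
    ((hu n).sub (hv n)) (hd n)).congr_of_eventuallyEq (.of_forall fun s => hs2 n s)
  have hdm := hd (n-1)
  have hd0 := hd n
  have hdp := hd (n+1)
  rw [h1.deriv, h2.deriv]
  simp only [Pi.mul_apply, Pi.sub_apply, Pi.add_apply, heq1, heq2, hs1, hs2, H1mT, H2mT, hneg,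
    add_sub_cancel_right, sub_add_cancel]
  generalize u1 (n-1, t) = a, u2 (n-1, t) = a', u1 (n, t) = b, u2 (n, t) = b',
    u1 (n+1, t) = c, u2 (n+1, t) = c', u1 (n+1+1, t) = d, u2 (n+1+1, t) = d' at *
  constructor <;> field_simp <;> ring
end

section
/- Fix α ∈ ℂ. Let u¹, u² : ℤ × ℝ → ℂ be differentiable in t for each n, with u¹(n,t) ≠ u²(n,t) for all n, t, and suppose (u¹, u²) satisfies the modified Toda system: ∂ₜ u¹₀ = u¹₀·H¹/((u¹₋₁ − u²₋₁)(u¹₀ − u²₀)) and ∂ₜ u²₀ = −u²₀·H²/((u¹₋₁ − u²₋₁)(u²₀ − u¹₀)), where subscript ℓ denotes the shift n ↦ n+ℓ, H¹ = −αu²₋₁u¹₀ + αu¹₋₁u²₀ + u²₋₁(u¹₀)² − 2u²₋₁u²₀u¹₀ + u²₋₁(u²₀)² − u¹₋₁u¹₁u²₀ + u¹₁u²₋₁u²₀ + u¹₋₁u²₀u²₁ − u²₋₁u²₀u²₁, and H² = −αu²₋₁u¹₀ + αu¹₋₁u²₀ + u¹₋₁(u¹₀)² − u¹₋₁u¹₁u¹₀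 + u¹₁u²₋₁u¹₀ − 2u¹₋₁u²₀u¹₀ + u¹₋₁u²₁u¹₀ − u²₋₁u²₁u¹₀ + u¹₋₁(u²₀)². For λ ∈ ℂ define the 2×2 matrices M(n,t,λ) with rows (λ + (αu²₀ − u¹₁u¹₀ + u²₀u²₁)/(u¹₀ − u²₀), u¹₀u²₀(u¹₁ − u²₁ − α)/(u¹₀ − u²₀)), (−1, 0) and U(n,t,λ) with rows (0, u¹₀u²₀(u²₁ + α − u¹₁)/(u¹₀ − u²₀)), (1, λ + (αu²₋₁ − u¹₀u¹₋₁ + u²₋₁u²₀)/(u¹₋₁ − u²₋₁)). Then for all n, t, λ the Lax equation ∂ₜ M(n,t,λ) = U(n+1,t,λ) * M(n,t,λ) − M(n,t,λ) * U(n,t,λ) holds. -/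
/-- The S-part of the Lax pair of the modified Toda system. -/
noncomputable def MmToda (α : ℂ) (u1 u2 : ℤ × ℝ → ℂ) (n : ℤ) (t : ℝ) (lam : ℂ) :
    Matrix (Fin 2) (Fin 2) ℂ :=
  !![lam + (α * u2 (n, t) - u1 (n+1, t) * u1 (n, t) + u2 (n, t) * u2 (n+1, t))
        / (u1 (n, t) - u2 (n, t)),
     u1 (n, t) * u2 (n, t) * (u1 (n+1, t) - u2 (n+1, t) - α)
        / (u1 (n, t) - u2 (n, t));
     -1, 0]

/-- The t-part of the Lax pair of the modified Toda system. -/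
noncomputable def UmToda (α : ℂ) (u1 u2 : ℤ × ℝ → ℂ) (n : ℤ) (t : ℝ) (lam : ℂ) :
    Matrix (Fin 2) (Fin 2) ℂ :=
  !![0, u1 (n, t) * u2 (n, t) * (u2 (n+1, t) + α - u1 (n+1, t))
        / (u1 (n, t) - u2 (n, t));
     1, lam + (α * u2 (n-1, t) - u1 (n, t) * u1 (n-1, t) + u2 (n-1, t) * u2 (n, t))
        / (u1 (n-1, t) - u2 (n-1, t))]

theorem mToda_Lax_pair (α : ℂ) (u1 u2 : ℤ × ℝ → ℂ)
    (hdiff1 : ∀ n : ℤ, Differentiable ℝ (fun t => u1 (n, t)))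
    (hdiff2 : ∀ n : ℤ, Differentiable ℝ (fun t => u2 (n, t)))
    (hne : ∀ (n : ℤ) (t : ℝ), u1 (n, t) ≠ u2 (n, t))
    (heq1 : ∀ (n : ℤ) (t : ℝ),
      deriv (fun s => u1 (n, s)) t
        = u1 (n, t) * H1mT α u1 u2 n t
          / ((u1 (n-1, t) - u2 (n-1, t)) * (u1 (n, t) - u2 (n, t))))
    (heq2 : ∀ (n : ℤ) (t : ℝ),
      deriv (fun s => u2 (n, s)) t
        = -(u2 (n, t) * H2mT α u1 u2 n t)
          / ((u1 (n-1, t) - u2 (n-1, t)) * (u2 (n, t) - u1 (n, t)))) :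
    ∀ (n : ℤ) (t : ℝ) (lam : ℂ) (i j : Fin 2),
      deriv (fun s => MmToda α u1 u2 n s lam i j) t
        = (UmToda α u1 u2 (n+1) t lam * MmToda α u1 u2 n t lam
            - MmToda α u1 u2 n t lam * UmToda α u1 u2 n t lam) i j := by
  intro n t lam i j
  have hd1 : ∀ m : ℤ, HasDerivAt (fun s => u1 (m, s)) (deriv (fun s => u1 (m, s)) t) t :=
    fun m => (hdiff1 m t).hasDerivAt
  have hd2 : ∀ m : ℤ, HasDerivAt (fun s => u2 (m, s)) (deriv (fun s => u2 (m, s)) t) t :=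
    fun m => (hdiff2 m t).hasDerivAt
  have hx := hd1 n
  have hy := hd2 n
  have hX := hd1 (n+1)
  have hY := hd2 (n+1)
  rw [heq1, H1mT] at hx hX
  rw [heq2, H2mT] at hy hY
  have e1 : n + 1 - 1 = n := by ring
  rw [e1] at hX hY
  have n0 := sub_ne_zero.2 (hne (n-1) t)
  have n1 := sub_ne_zero.2 (hne n t)
  have n2 := sub_ne_zero.2 (hne (n+1) t)
  fin_cases i <;> fin_cases j
  · have h := ((((hy.const_mul α).fun_sub (hX.fun_mul hx)).fun_add (hy.fun_mul hY)).fun_div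
      (hx.fun_sub hy) n1).const_add lam
    simp only [MmToda, UmToda, Matrix.sub_apply, Matrix.mul_apply, Fin.sum_univ_two, Fin.zero_eta,
      Matrix.of_apply, Matrix.cons_val', Matrix.cons_val_zero, Matrix.cons_val_one,
      Matrix.cons_val_fin_one]
    rw [h.deriv]
    rw [← neg_sub (u1 (n, t)) (u2 (n, t)), ← neg_sub (u1 (n+1, t)) (u2 (n+1, t))]
    field_simp
    ring
  · have h := ((hx.fun_mul hy).fun_mul ((hX.fun_sub hY).sub_const α)).fun_div (hx.fun_sub hy) n1
    simp only [MmToda, UmToda, Matrix.sub_apply, Matrix.mul_apply, Fin.sum_univ_two, Fin.zero_eta,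
      Fin.mk_one, Matrix.of_apply, Matrix.cons_val', Matrix.cons_val_zero, Matrix.cons_val_one,
      Matrix.cons_val_fin_one]
    rw [h.deriv]
    rw [← neg_sub (u1 (n, t)) (u2 (n, t)), ← neg_sub (u1 (n+1, t)) (u2 (n+1, t))]
    field_simp
    ring
  · simp [MmToda, UmToda, e1]
  · simp [MmToda, UmToda]
    ring
end

section
/- Fix α ∈ ℂ. For u₀ = (u¹₀, u²₀), u₁ = (u¹₁, u²₁) ∈ ℂ² and λ ∈ ℂ with u¹₀ ≠ u²₀, u¹₀u²₀ ≠ 0 and u¹₁ − u²₁ − α ≠ 0, let M(u₀, u₁, λ) be the 2×2 complex matrix with rows (λ + (αu²₀ − u¹₁u¹₀ + u²₀u²₁)/(u¹₀ − u²₀), u¹₀u²₀(u¹₁ − u²₁ − α)/(u¹₀ − u²₀)) and (−1, 0). Then M(u₀, u₁, λ) is invertible and, for all i, j ∈ {1, 2}, ∂/∂u₀^i ( (∂/∂u₁^j M(u₀,u₁,λ)) * M(u₀,u₁,λ)⁻¹ ) = 0 wherever M is defined; that is, M satisfies the 1-flatness condition in the 2-component case D = 2. -/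
/-- The S-part of the Lax pair of the modified Toda system, as a function of the
blocks `u₀ = (u₀¹, u₀²)`, `u₁ = (u₁¹, u₁²)` and the spectral parameter `λ`. -/
noncomputable def MmTodaS (α : ℂ) (u₀ u₁ : Fin 2 → ℂ) (lam : ℂ) :
    Matrix (Fin 2) (Fin 2) ℂ :=
  !![lam + (α * u₀ 1 - u₁ 0 * u₀ 0 + u₀ 1 * u₁ 1) / (u₀ 0 - u₀ 1),
     u₀ 0 * u₀ 1 * (u₁ 0 - u₁ 1 - α) / (u₀ 0 - u₀ 1);
     -1, 0]

theorem MmTodaS_det (α : ℂ) (w v : Fin 2 → ℂ) (lam : ℂ) :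
    (MmTodaS α w v lam).det = w 0 * w 1 * (v 0 - v 1 - α) / (w 0 - w 1) := by
  simp [MmTodaS, Matrix.det_fin_two]

/-- The entries of `MmTodaS` are affine in the second block, with the evident directional
derivatives. -/
theorem fderiv_MmTodaS (α : ℂ) (w u v : Fin 2 → ℂ) (lam : ℂ) :
    (Matrix.of fun a b => fderiv ℂ (fun x : Fin 2 → ℂ => MmTodaS α w x lam a b) u v) =
      !![(w 1 * v 1 - v 0 * w 0) / (w 0 - w 1),
         w 0 * w 1 * (v 0 - v 1) / (w 0 - w 1); 0, 0] := by
  have hp (k : Fin 2) : HasFDerivAt (fun x : Fin 2 → ℂ => x k)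
      (ContinuousLinearMap.proj (R := ℂ) (φ := fun _ : Fin 2 => ℂ) k) u :=
    hasFDerivAt_apply k u
  have hA := ((((hp 0).mul_const (w 0)).const_sub (α * w 1)).add
    ((hp 1).const_mul (w 1))).mul_const (w 0 - w 1)⁻¹ |>.const_add lam
  have hB := ((((hp 0).sub (hp 1)).sub_const α).const_mul (w 0 * w 1)).mul_const (w 0 - w 1)⁻¹
  ext a b
  fin_cases a <;> fin_cases b
  · have h : HasFDerivAt (fun x : Fin 2 → ℂ => MmTodaS α w x lam 0 0) _ u := hA
    simp [h.fderiv]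
    ring
  · have h : HasFDerivAt (fun x : Fin 2 → ℂ => MmTodaS α w x lam 0 1) _ u := hB
    simp [h.fderiv]
    ring
  · simp [MmTodaS]
  · simp [MmTodaS]

/-- Where it is defined, the logarithmic derivative of `MmTodaS` in the second block does not
depend on the first block. -/
theorem fderiv_MmTodaS_mul_inv (α : ℂ) (w u : Fin 2 → ℂ) (lam : ℂ) (j : Fin 2)
    (h1 : w 0 ≠ w 1) (h2 : w 0 * w 1 ≠ 0) (h3 : u 0 - u 1 - α ≠ 0) :
    (Matrix.of fun a b => fderiv ℂ (fun x : Fin 2 → ℂ => MmTodaS α w x lam a b) u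
        (Pi.single j (1 : ℂ))) * (MmTodaS α w u lam)⁻¹ =
      (u 0 - u 1 - α)⁻¹ • (![!![1, lam - u 1 - α; 0, 0], !![-1, u 0 - lam; 0, 0]] j) := by
  have hd : w 0 - w 1 ≠ 0 := sub_ne_zero.mpr h1
  have hdet : IsUnit (MmTodaS α w u lam).det := by
    rw [MmTodaS_det]
    exact (div_ne_zero (mul_ne_zero h2 h3) hd).isUnit
  rw [fderiv_MmTodaS]
  have := Matrix.invertibleOfIsUnitDet _ hdet
  rw [Matrix.mul_inv_eq_iff_eq_mul_of_invertible]
  fin_cases j <;> ext a b <;> fin_cases a <;> fin_cases b <;>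
    simp [MmTodaS, Matrix.mul_apply, Fin.sum_univ_two] <;> field_simp <;> ring

/-- The S-part of the Lax pair of the modified Toda system satisfies the
1-flatness condition in the 2-component case `D = 2`. -/
theorem mToda_S_part_one_flat (α : ℂ) (u₀ u₁ : Fin 2 → ℂ) (lam : ℂ)
    (h1 : u₀ 0 ≠ u₀ 1) (h2 : u₀ 0 * u₀ 1 ≠ 0) (h3 : u₁ 0 - u₁ 1 - α ≠ 0) :
    IsUnit (MmTodaS α u₀ u₁ lam) ∧
    ∀ (i j : Fin 2) (a b : Fin 2),
      fderiv ℂ (fun w : Fin 2 → ℂ =>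
          ((Matrix.of fun a' b' =>
              fderiv ℂ (fun v : Fin 2 → ℂ => MmTodaS α w v lam a' b') u₁
                (Pi.single j (1:ℂ)))
            * (MmTodaS α w u₁ lam)⁻¹) a b) u₀ (Pi.single i (1:ℂ)) = 0 := by
  refine ⟨?_, fun i j a b => ?_⟩
  · rw [Matrix.isUnit_iff_isUnit_det, MmTodaS_det]
    exact (div_ne_zero (mul_ne_zero h2 h3) (sub_ne_zero.mpr h1)).isUnit
  · have hne : ∀ᶠ w : Fin 2 → ℂ in nhds u₀, w 0 ≠ w 1 ∧ w 0 * w 1 ≠ 0 :=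
      ((isOpen_ne_fun (continuous_apply 0) (continuous_apply 1)).eventually_mem h1).and
        (ContinuousAt.eventually_ne (by fun_prop) h2)
    rw [Filter.EventuallyEq.fderiv_eq (hne.mono fun w hw =>
      congrFun (congrFun (fderiv_MmTodaS_mul_inv α w u₁ lam j hw.1 hw.2 h3) a) b)]
    simp
end

section
/- Fix α ∈ ℂ. Let u¹, u² : ℤ × ℝ → ℂ be differentiable in t for each n, with u¹(n,t) ≠ u²(n,t) for all n, t, and suppose (u¹, u²) satisfies the modified Toda system: ∂ₜ u¹₀ = u¹₀·H¹/((u¹₋₁ − u²₋₁)(u¹₀ − u²₀)) and ∂ₜ u²₀ = −u²₀·H²/((u¹₋₁ − u²₋₁)(u²₀ − u¹₀)), where subscript ℓ denotes the shift n ↦ n+ℓ, H¹ = −αu²₋₁u¹₀ + αu¹₋₁u²₀ + u²₋₁(u¹₀)² − 2u²₋₁u²₀u¹₀ + u²₋₁(u²₀)² − u¹₋₁u¹₁u²₀ + u¹₁u²₋₁u²₀ + u¹₋₁u²₀u²₁ − u²₋₁u²₀u²₁, and H² = −αu²₋₁u¹₀ + αu¹₋₁u²₀ + u¹₋₁(u¹₀)²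 − u¹₋₁u¹₁u¹₀ + u¹₁u²₋₁u¹₀ − 2u¹₋₁u²₀u¹₀ + u¹₋₁u²₁u¹₀ − u²₋₁u²₁u¹₀ + u¹₋₁(u²₀)². For λ ∈ ℂ define the 2×2 matrices M̃(n,t,λ) with rows (λ + α − 2u¹₀ + u²₀, −2(α − u¹₀ + u²₀)) and ((1/2)(λ + α − 2u¹₀ + 2u²₀ − (λ+α)u²₀/(u¹₀ − u²₀)), (u¹₀ − 2u²₀)(−α + u¹₀ − u²₀)/(u¹₀ − u²₀)), and Ũ(n,t,λ) with rows (−(u¹₋₁ − 2u²₋₁)(α − u¹₀ + u²₀)/(u¹₋₁ − u²₋₁), 2(α − u¹₀ + u²₀)) and (u¹₀ − u²₀ + (λ+α)(2u²₋₁ − u¹₋₁)/(2(u¹₋₁ − u²₋₁)), λ + α − (2u¹₋₁ − u²₋₁)(u¹₀ − u²₀)/(u¹₋₁ − u²₋₁)). Then for all n, t, λ the Lax equation ∂ₜ M̃(n,t,λ) = Ũ(n+1,t,λ) * M̃(n,t,λ) − M̃(n,t,λ) * Ũ(n,t,λ) holds. -/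
/-- The S-part of the gauge-transformed Lax pair of the modified Toda system. -/
noncomputable def MtmToda (α : ℂ) (u1 u2 : ℤ × ℝ → ℂ) (n : ℤ) (t : ℝ) (lam : ℂ) :
    Matrix (Fin 2) (Fin 2) ℂ :=
  !![lam + α - 2 * u1 (n, t) + u2 (n, t), -2 * (α - u1 (n, t) + u2 (n, t));
     (1/2) * (lam + α - 2 * u1 (n, t) + 2 * u2 (n, t)
        - (lam + α) * u2 (n, t) / (u1 (n, t) - u2 (n, t))),
       (u1 (n, t) - 2 * u2 (n, t)) * (-α + u1 (n, t) - u2 (n, t))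
         / (u1 (n, t) - u2 (n, t))]

/-- The t-part of the gauge-transformed Lax pair of the modified Toda system. -/
noncomputable def UtmToda (α : ℂ) (u1 u2 : ℤ × ℝ → ℂ) (n : ℤ) (t : ℝ) (lam : ℂ) :
    Matrix (Fin 2) (Fin 2) ℂ :=
  !![-(u1 (n-1, t) - 2 * u2 (n-1, t)) * (α - u1 (n, t) + u2 (n, t))
        / (u1 (n-1, t) - u2 (n-1, t)),
     2 * (α - u1 (n, t) + u2 (n, t));
     u1 (n, t) - u2 (n, t)
       + (lam + α) * (2 * u2 (n-1, t) - u1 (n-1, t))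
         / (2 * (u1 (n-1, t) - u2 (n-1, t))),
     lam + α - (2 * u1 (n-1, t) - u2 (n-1, t)) * (u1 (n, t) - u2 (n, t))
       / (u1 (n-1, t) - u2 (n-1, t))]

/-- The derivative of a quotient of complex-valued functions of a real variable. -/
theorem hasDerivAt_div_real {f g : ℝ → ℂ} {a b : ℂ} {t : ℝ} (hf : HasDerivAt f a t)
    (hg : HasDerivAt g b t) (h : g t ≠ 0) :
    HasDerivAt (fun s => f s / g s) ((a * g t - f t * b) / g t ^ 2) t :=
  hf.fun_div hg h

/-- The entrywise time derivative of `MtmToda` in terms of those of `u1` and `u2`. -/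
theorem hasDerivAt_MtmToda (α : ℂ) (u1 u2 : ℤ × ℝ → ℂ) (n : ℤ) (t : ℝ) (lam a b : ℂ)
    (ha : HasDerivAt (fun s => u1 (n, s)) a t) (hb : HasDerivAt (fun s => u2 (n, s)) b t)
    (h : u1 (n, t) - u2 (n, t) ≠ 0) (i j : Fin 2) :
    HasDerivAt (fun s => MtmToda α u1 u2 n s lam i j)
      ((!![-2 * a + b, 2 * (a - b);
          (1/2) * (-2 * a + 2 * b
            - ((lam + α) * b * (u1 (n, t) - u2 (n, t)) - (lam + α) * u2 (n, t) * (a - b))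
              / (u1 (n, t) - u2 (n, t)) ^ 2),
          (((a - 2 * b) * (-α + u1 (n, t) - u2 (n, t))
              + (u1 (n, t) - 2 * u2 (n, t)) * (a - b)) * (u1 (n, t) - u2 (n, t))
            - (u1 (n, t) - 2 * u2 (n, t)) * (-α + u1 (n, t) - u2 (n, t)) * (a - b))
              / (u1 (n, t) - u2 (n, t)) ^ 2] : Matrix (Fin 2) (Fin 2) ℂ) i j) t := by
  have hab := ha.fun_sub hb
  fin_cases i <;> fin_cases j <;> simp only [MtmToda, Matrix.of_apply, Matrix.cons_val',
    Matrix.cons_val_zero, Matrix.cons_val_one, Matrix.cons_val_fin_one, Fin.zero_eta, Fin.mk_one]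
  · exact (((ha.const_mul 2).const_sub (lam + α)).fun_add hb).congr_deriv (by ring)
  · exact (((ha.const_sub α).fun_add hb).const_mul (-2)).congr_deriv (by ring)
  · exact (((((ha.const_mul 2).const_sub (lam + α)).fun_add (hb.const_mul 2)).fun_sub
      (hasDerivAt_div_real (hb.const_mul (lam + α)) hab h)).const_mul (1/2)).congr_deriv (by ring)
  · exact (hasDerivAt_div_real ((ha.fun_sub (hb.const_mul 2)).fun_mul
      ((ha.const_add (-α)).fun_sub hb)) hab h).congr_deriv (by ring)

theorem gauge_transformed_mToda_Lax_pair (α : ℂ) (u1 u2 : ℤ × ℝ → ℂ)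
    (hdiff1 : ∀ n : ℤ, Differentiable ℝ (fun t => u1 (n, t)))
    (hdiff2 : ∀ n : ℤ, Differentiable ℝ (fun t => u2 (n, t)))
    (hne : ∀ (n : ℤ) (t : ℝ), u1 (n, t) ≠ u2 (n, t))
    (heq1 : ∀ (n : ℤ) (t : ℝ),
      deriv (fun s => u1 (n, s)) t
        = u1 (n, t) * H1mT α u1 u2 n t
          / ((u1 (n-1, t) - u2 (n-1, t)) * (u1 (n, t) - u2 (n, t))))
    (heq2 : ∀ (n : ℤ) (t : ℝ),
      deriv (fun s => u2 (n, s)) t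
        = -(u2 (n, t) * H2mT α u1 u2 n t)
          / ((u1 (n-1, t) - u2 (n-1, t)) * (u2 (n, t) - u1 (n, t)))) :
    ∀ (n : ℤ) (t : ℝ) (lam : ℂ) (i j : Fin 2),
      deriv (fun s => MtmToda α u1 u2 n s lam i j) t
        = (UtmToda α u1 u2 (n+1) t lam * MtmToda α u1 u2 n t lam
            - MtmToda α u1 u2 n t lam * UtmToda α u1 u2 n t lam) i j := by
  intro n t lam i j
  have h0 : u1 (n, t) - u2 (n, t) ≠ 0 := sub_ne_zero.mpr (hne n t)
  have hm : u1 (n-1, t) - u2 (n-1, t) ≠ 0 := sub_ne_zero.mpr (hne (n-1) t)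
  have ha := (hdiff1 n t).hasDerivAt
  have hb := (hdiff2 n t).hasDerivAt
  have e2 : -(u2 (n, t) * H2mT α u1 u2 n t)
      / ((u1 (n-1, t) - u2 (n-1, t)) * (u2 (n, t) - u1 (n, t)))
      = u2 (n, t) * H2mT α u1 u2 n t
        / ((u1 (n-1, t) - u2 (n-1, t)) * (u1 (n, t) - u2 (n, t))) := by
    rw [← neg_sub (u1 (n, t)), mul_neg, neg_div_neg_eq]
  rw [heq1] at ha
  rw [heq2, e2] at hb
  rw [(hasDerivAt_MtmToda α u1 u2 n t lam _ _ ha hb h0 i j).deriv]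
  simp only [Matrix.sub_apply, Matrix.mul_apply, Fin.sum_univ_two, MtmToda, UtmToda, H1mT, H2mT,
    add_sub_cancel_right]
  generalize u1 (n, t) = p at *
  generalize u2 (n, t) = q at *
  generalize u1 (n-1, t) = x at *
  generalize u2 (n-1, t) = y at *
  generalize u1 (n+1, t) = z at *
  generalize u2 (n+1, t) = w at *
  clear * - h0 hm
  fin_cases i <;> fin_cases j <;> simp only [Matrix.of_apply, Matrix.cons_val',
    Matrix.cons_val_zero, Matrix.cons_val_one, Matrix.cons_val_fin_one, Fin.zero_eta, Fin.mk_one]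
  all_goals
    field_simp
    ring
end

section
/- Let w¹, w² : ℤ × ℝ → ℂ be differentiable in t for each n. Write subscript ℓ for the shift n ↦ n+ℓ, and set Q = w¹₀w¹₁w²₀ + w¹₁w²₀ − w¹₀w²₁w²₀ + w¹₁w²₁w²₀ − w¹₀w²₁ − w¹₀w¹₁w²₁ and P = −w¹₋₁w¹₁w²₀(w¹₀)² + w¹₋₁w²₁(w¹₀)² + w¹₋₁w¹₁w²₁(w¹₀)² + w¹₁w²₁(w¹₀)² + w¹₋₁w²₀w²₁(w¹₀)² + w¹₁w²₀w²₁(w¹₀)² + w²₀w²₁(w¹₀)² + w²₁(w¹₀)² − 2w¹₋₁w¹₁w²₀w¹₀ − 2w¹₋₁w¹₁w²₀w²₁w¹₀ − w¹₋₁w¹₁w²₀ − w¹₋₁w¹₁w²₀w²₁. Suppose that for all n, t one has Q ≠ 0, w¹₁ ≠ w¹₀, and that (w¹, w²) satisfies the system ∂ₜ w¹₀ = −w¹₀(w¹₀ + 1)(w¹₀w¹₁ + w²₁w¹₁ + w¹₁ − w¹₀w²₁)/Q and ∂ₜ w²₀ = P/((w¹₋₁ − w¹₀)·Q). Define u¹(n,t)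 := w¹₀(w¹₁ + 1)(w¹₀w¹₁ + w²₁w¹₁ + w¹₁ − w¹₀w²₁)/((w¹₁ − w¹₀)·(−Q)) and u²(n,t) := (w¹₀ + 1)w¹₁(w¹₀w¹₁ + w²₁w¹₁ + w¹₁ − w¹₀w²₁)/((w¹₁ − w¹₀)·(−Q)), and assume u¹(n,t) ≠ u²(n,t) for all n, t. Then (u¹, u²) satisfies the modified Toda system with α = 0: ∂ₜ u¹₀ = u¹₀·H¹/((u¹₋₁ − u²₋₁)(u¹₀ − u²₀)) and ∂ₜ u²₀ = −u²₀·H²/((u¹₋₁ − u²₋₁)(u²₀ − u¹₀)), where H¹ = u²₋₁(u¹₀)² − 2u²₋₁u²₀u¹₀ + u²₋₁(u²₀)² − u¹₋₁u¹₁u²₀ + u¹₁u²₋₁u²₀ + u¹₋₁u²₀u²₁ − u²₋₁u²₀u²₁ and H² = u¹₋₁(u¹₀)² − u¹₋₁u¹₁u¹₀ + u¹₁u²₋₁u¹₀ − 2u¹₋₁u²₀u¹₀ + u¹₋₁u²₁u¹₀ − u²₋₁u²₁u¹₀ + u¹₋₁(u²₀)². That is, these formulas give a Miura-type transformation from the doubly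 modified Toda system for (w¹, w²) to the modified Toda system with α = 0. -/
/-- The denominator `Q` of the doubly modified Toda system. -/
noncomputable def QdmT (w1 w2 : ℤ × ℝ → ℂ) (n : ℤ) (t : ℝ) : ℂ :=
  w1 (n, t) * w1 (n+1, t) * w2 (n, t) + w1 (n+1, t) * w2 (n, t)
  - w1 (n, t) * w2 (n+1, t) * w2 (n, t) + w1 (n+1, t) * w2 (n+1, t) * w2 (n, t)
  - w1 (n, t) * w2 (n+1, t) - w1 (n, t) * w1 (n+1, t) * w2 (n+1, t)

/-- The numerator `P` of the doubly modified Toda system. -/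
noncomputable def PdmT (w1 w2 : ℤ × ℝ → ℂ) (n : ℤ) (t : ℝ) : ℂ :=
  -w1 (n-1, t) * w1 (n+1, t) * w2 (n, t) * (w1 (n, t))^2
  + w1 (n-1, t) * w2 (n+1, t) * (w1 (n, t))^2
  + w1 (n-1, t) * w1 (n+1, t) * w2 (n+1, t) * (w1 (n, t))^2
  + w1 (n+1, t) * w2 (n+1, t) * (w1 (n, t))^2
  + w1 (n-1, t) * w2 (n, t) * w2 (n+1, t) * (w1 (n, t))^2
  + w1 (n+1, t) * w2 (n, t) * w2 (n+1, t) * (w1 (n, t))^2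
  + w2 (n, t) * w2 (n+1, t) * (w1 (n, t))^2
  + w2 (n+1, t) * (w1 (n, t))^2
  - 2 * w1 (n-1, t) * w1 (n+1, t) * w2 (n, t) * w1 (n, t)
  - 2 * w1 (n-1, t) * w1 (n+1, t) * w2 (n, t) * w2 (n+1, t) * w1 (n, t)
  - w1 (n-1, t) * w1 (n+1, t) * w2 (n, t)
  - w1 (n-1, t) * w1 (n+1, t) * w2 (n, t) * w2 (n+1, t)

/-- The numerator of the common factor `u¹ - u²` of the transformed fields. -/
noncomputable def numdmT (w1 w2 : ℤ × ℝ → ℂ) (n : ℤ) (t : ℝ) : ℂ :=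
  w1 (n, t) * w1 (n+1, t) + w2 (n+1, t) * w1 (n+1, t) + w1 (n+1, t) - w1 (n, t) * w2 (n+1, t)

/-- Along the doubly modified Toda flow, `D = u¹ - u² = numdmT / QdmT` satisfies
`D' = D² (w¹₀ (w¹₋₁ + 1) / (w¹₋₁ - w¹₀) - w¹₁ (w¹₀ + 1) / (w¹₀ - w¹₁))`. -/
theorem hasDerivAt_numdmT_div_QdmT {w1 w2 : ℤ × ℝ → ℂ} {n : ℤ} {t : ℝ}
    (hQ : ∀ m : ℤ, QdmT w1 w2 m t ≠ 0) (hw : ∀ m : ℤ, w1 (m+1, t) ≠ w1 (m, t))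
    (h1 : ∀ m : ℤ, HasDerivAt (fun s => w1 (m, s))
      (-(w1 (m, t) * (w1 (m, t) + 1) * (numdmT w1 w2 m t / QdmT w1 w2 m t))) t)
    (h2 : ∀ m : ℤ, HasDerivAt (fun s => w2 (m, s))
      (PdmT w1 w2 m t / ((w1 (m-1, t) - w1 (m, t)) * QdmT w1 w2 m t)) t) :
    HasDerivAt (fun s => numdmT w1 w2 n s / QdmT w1 w2 n s)
      ((numdmT w1 w2 n t / QdmT w1 w2 n t) ^ 2
        * (w1 (n, t) * (w1 (n-1, t) + 1) / (w1 (n-1, t) - w1 (n, t))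
          - w1 (n+1, t) * (w1 (n, t) + 1) / (w1 (n, t) - w1 (n+1, t)))) t := by
  have hb := h1 n
  have hc := h1 (n+1)
  have hx := h2 n
  have hy := h2 (n+1)
  have hN : HasDerivAt (fun s => numdmT w1 w2 n s) _ t :=
    (((hb.mul hc).add (hy.mul hc)).add hc).sub (hb.mul hy)
  have hQ' : HasDerivAt (fun s => QdmT w1 w2 n s) _ t :=
    ((((((hb.mul hc).mul hx).add (hc.mul hx)).sub ((hb.mul hy).mul hx)).add
      ((hc.mul hy).mul hx)).sub (hb.mul hy)).sub ((hb.mul hc).mul hy)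
  refine (hN.div hQ' (hQ n)).congr_deriv ?_
  have hq0 := hQ n
  have hq1 := hQ (n+1)
  have hab : w1 (n-1, t) - w1 (n, t) ≠ 0 := by
    simpa [sub_ne_zero] using (hw (n-1)).symm
  have hbc : w1 (n, t) - w1 (n+1, t) ≠ 0 := sub_ne_zero.2 (hw n).symm
  have dQ0 := QdmT.eq_1 w1 w2 n t
  have dQ1 := QdmT.eq_1 w1 w2 (n+1) t
  have dN0 := numdmT.eq_1 w1 w2 n t
  have dN1 := numdmT.eq_1 w1 w2 (n+1) t
  have dP0 := PdmT.eq_1 w1 w2 n t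
  have dP1 := PdmT.eq_1 w1 w2 (n+1) t
  simp only [Pi.mul_apply, add_sub_cancel_right] at dP1 ⊢
  clear hN hQ' hb hc hx hy h1 h2 hQ hw
  generalize QdmT w1 w2 n t = Q₀ at *
  generalize QdmT w1 w2 (n+1) t = Q₁ at *
  generalize numdmT w1 w2 n t = N₀ at *
  generalize numdmT w1 w2 (n+1) t = N₁ at *
  generalize PdmT w1 w2 n t = P₀ at *
  generalize PdmT w1 w2 (n+1) t = P₁ at *
  generalize w1 (n-1, t) = a at *
  generalize w1 (n, t) = b at *
  generalize w1 (n+1, t) = c at *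
  generalize w1 (n+1+1, t) = d at *
  generalize w2 (n, t) = x at *
  generalize w2 (n+1, t) = y at *
  generalize w2 (n+1+1, t) = z at *
  field_simp
  rw [dN0, dN1, dP0, dP1, dQ0, dQ1]
  ring

/-- The Miura-type transformation from the doubly modified Toda system to the
modified Toda system with `α = 0`. -/
theorem miura_dmToda_to_mToda (w1 w2 u1 u2 : ℤ × ℝ → ℂ)
    (hdiff1 : ∀ n : ℤ, Differentiable ℝ (fun t => w1 (n, t)))
    (hdiff2 : ∀ n : ℤ, Differentiable ℝ (fun t => w2 (n, t)))
    (hQ : ∀ (n : ℤ) (t : ℝ), QdmT w1 w2 n t ≠ 0)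
    (hw : ∀ (n : ℤ) (t : ℝ), w1 (n+1, t) ≠ w1 (n, t))
    (heqw1 : ∀ (n : ℤ) (t : ℝ),
      deriv (fun s => w1 (n, s)) t
        = -(w1 (n, t) * (w1 (n, t) + 1)
            * (w1 (n, t) * w1 (n+1, t) + w2 (n+1, t) * w1 (n+1, t)
               + w1 (n+1, t) - w1 (n, t) * w2 (n+1, t)))
          / QdmT w1 w2 n t)
    (heqw2 : ∀ (n : ℤ) (t : ℝ),
      deriv (fun s => w2 (n, s)) t
        = PdmT w1 w2 n t / ((w1 (n-1, t) - w1 (n, t)) * QdmT w1 w2 n t))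
    (hu1 : ∀ (n : ℤ) (t : ℝ),
      u1 (n, t) = w1 (n, t) * (w1 (n+1, t) + 1)
          * (w1 (n, t) * w1 (n+1, t) + w2 (n+1, t) * w1 (n+1, t)
             + w1 (n+1, t) - w1 (n, t) * w2 (n+1, t))
        / ((w1 (n+1, t) - w1 (n, t)) * (-QdmT w1 w2 n t)))
    (hu2 : ∀ (n : ℤ) (t : ℝ),
      u2 (n, t) = (w1 (n, t) + 1) * w1 (n+1, t)
          * (w1 (n, t) * w1 (n+1, t) + w2 (n+1, t) * w1 (n+1, t)
             + w1 (n+1, t) - w1 (n, t) * w2 (n+1, t))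
        / ((w1 (n+1, t) - w1 (n, t)) * (-QdmT w1 w2 n t)))
    (hne : ∀ (n : ℤ) (t : ℝ), u1 (n, t) ≠ u2 (n, t)) :
    ∀ (n : ℤ) (t : ℝ),
      deriv (fun s => u1 (n, s)) t
        = u1 (n, t)
          * (u2 (n-1, t) * (u1 (n, t))^2 - 2 * u2 (n-1, t) * u2 (n, t) * u1 (n, t)
             + u2 (n-1, t) * (u2 (n, t))^2 - u1 (n-1, t) * u1 (n+1, t) * u2 (n, t)
             + u1 (n+1, t) * u2 (n-1, t) * u2 (n, t)
             + u1 (n-1, t) * u2 (n, t) * u2 (n+1, t)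
             - u2 (n-1, t) * u2 (n, t) * u2 (n+1, t))
          / ((u1 (n-1, t) - u2 (n-1, t)) * (u1 (n, t) - u2 (n, t))) ∧
      deriv (fun s => u2 (n, s)) t
        = -(u2 (n, t)
          * (u1 (n-1, t) * (u1 (n, t))^2 - u1 (n-1, t) * u1 (n+1, t) * u1 (n, t)
             + u1 (n+1, t) * u2 (n-1, t) * u1 (n, t)
             - 2 * u1 (n-1, t) * u2 (n, t) * u1 (n, t)
             + u1 (n-1, t) * u2 (n+1, t) * u1 (n, t)
             - u2 (n-1, t) * u2 (n+1, t) * u1 (n, t)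
             + u1 (n-1, t) * (u2 (n, t))^2))
          / ((u1 (n-1, t) - u2 (n-1, t)) * (u2 (n, t) - u1 (n, t))) := by
  intro n t
  have h1 : ∀ m : ℤ, HasDerivAt (fun s => w1 (m, s))
      (-(w1 (m, t) * (w1 (m, t) + 1) * (numdmT w1 w2 m t / QdmT w1 w2 m t))) t := fun m => by
    refine ((hdiff1 m t).hasDerivAt).congr_deriv ?_
    rw [heqw1, numdmT, neg_div, mul_div_assoc]
  have h2 : ∀ m : ℤ, HasDerivAt (fun s => w2 (m, s))
      (PdmT w1 w2 m t / ((w1 (m-1, t) - w1 (m, t)) * QdmT w1 w2 m t)) t := fun m => by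
    rw [← heqw2]
    exact (hdiff2 m t).hasDerivAt
  have hbc : ∀ (m : ℤ) (s : ℝ), w1 (m, s) - w1 (m+1, s) ≠ 0 :=
    fun m s => sub_ne_zero.2 (hw m s).symm
  have hu1' : ∀ (m : ℤ) (s : ℝ), u1 (m, s) =
      w1 (m, s) * (w1 (m+1, s) + 1) / (w1 (m, s) - w1 (m+1, s))
        * (numdmT w1 w2 m s / QdmT w1 w2 m s) := fun m s => by
    rw [hu1, ← numdmT, mul_neg, ← neg_mul, neg_sub, mul_div_mul_comm]
  have hu2' : ∀ (m : ℤ) (s : ℝ), u2 (m, s) =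
      (w1 (m, s) + 1) * w1 (m+1, s) / (w1 (m, s) - w1 (m+1, s))
        * (numdmT w1 w2 m s / QdmT w1 w2 m s) := fun m s => by
    rw [hu2, ← numdmT, mul_neg, ← neg_mul, neg_sub, mul_div_mul_comm]
  have hsub : ∀ m : ℤ, numdmT w1 w2 m t / QdmT w1 w2 m t ≠ 0 := fun m h => by
    apply hne m t
    rw [hu1', hu2', h, mul_zero, mul_zero]
  have hD := hasDerivAt_numdmT_div_QdmT (n := n) (fun m => hQ m t) (fun m => hw m t) h1 h2
  have hb := h1 n
  have hc := h1 (n+1)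
  have hB := hb.sub hc
  have e1 := (((hb.mul (hc.add_const 1)).div hB (hbc n t)).mul hD).deriv
  have e2 := ((((hb.add_const 1).mul hc).div hB (hbc n t)).mul hD).deriv
  have f1 : (fun s => u1 (n, s)) = _ := funext fun s => hu1' n s
  have f2 : (fun s => u2 (n, s)) = _ := funext fun s => hu2' n s
  have hd0 : ∀ m : ℤ, u1 (m, t) - u2 (m, t) = numdmT w1 w2 m t / QdmT w1 w2 m t := fun m => by
    have := hbc m t
    rw [hu1', hu2', ← sub_mul, ← sub_div]
    rw [show w1 (m, t) * (w1 (m+1, t) + 1) - (w1 (m, t) + 1) * w1 (m+1, t)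
      = w1 (m, t) - w1 (m+1, t) by ring, div_self this, one_mul]
  have hab := hbc (n-1) t
  have hbc0 := hbc n t
  have hcd := hbc (n+1) t
  have ha0 := hsub (n-1)
  have hb0 := hsub n
  rw [← neg_sub (u1 (n, t)) (u2 (n, t)), hd0, hd0]
  constructor
  · rw [f1]
    refine e1.trans ?_
    simp only [hu1', hu2', Pi.mul_apply, Pi.div_apply, Pi.sub_apply, sub_add_cancel] at hab ⊢
    generalize numdmT w1 w2 (n-1) t / QdmT w1 w2 (n-1) t = A at *
    generalize numdmT w1 w2 n t / QdmT w1 w2 n t = B at *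
    generalize numdmT w1 w2 (n+1) t / QdmT w1 w2 (n+1) t = C at *
    field_simp
    ring
  · rw [f2]
    refine e2.trans ?_
    simp only [hu1', hu2', Pi.mul_apply, Pi.div_apply, Pi.sub_apply, sub_add_cancel] at hab ⊢
    generalize numdmT w1 w2 (n-1) t / QdmT w1 w2 (n-1) t = A at *
    generalize numdmT w1 w2 n t / QdmT w1 w2 n t = B at *
    generalize numdmT w1 w2 (n+1) t / QdmT w1 w2 (n+1) t = C at *
    field_simp
    ring
end
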